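/- arXiv:1608.07406 — 5 statements merged into one kernel-verified Lean document; each statement's English description precedes it below -/
import Mathlib

section
/- Let F ↪ E → B be a fibration of pointed spaces such that the inclusion F ↪ E of the fibre is null homotopic. Then the loop space ΩB is homotopy equivalent to F × ΩE. -/
open scoped unitInterval

/-- `p : E → B` is a (Hurewicz) fibration: it has the homotopy lifting property with respect to
all topological spaces. -/
def IsHurewiczFibration {E B : Type} [TopologicalSpace E] [TopologicalSpace B]
    (p : C(E, B)) : Prop :=
  ∀ (Z : Type) (_ : TopologicalSpace Z) (f : C(Z, E)) (H : C(Z × I, B)),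
    (∀ z, H (z, 0) = p (f z)) →
      ∃ G : C(Z × I, E), (∀ z, G (z, 0) = f z) ∧ ∀ q, p (G q) = H q

namespace Stmt7

variable {E B : Type} [TopologicalSpace E] [TopologicalSpace B]

noncomputable abbrev pr (x : ℝ) : I := Set.projIcc (0:ℝ) 1 zero_le_one x

lemma cpr : Continuous pr := continuous_projIcc

lemma pr_coe (u : I) : pr (u : ℝ) = u := Set.projIcc_val _ u

lemma pr_le {x : ℝ} (h : x ≤ 0) : pr x = 0 := Set.projIcc_of_le_left _ h
lemma pr_ge {x : ℝ} (h : 1 ≤ x) : pr x = 1 := Set.projIcc_of_right_le _ h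

lemma pr_val {x : ℝ} (h0 : 0 ≤ x) (h1 : x ≤ 1) : ((pr x : I) : ℝ) = x := by
  rw [pr, Set.projIcc_of_mem _ ⟨h0, h1⟩]

noncomputable def cat (a b : ℝ → E) (x : ℝ) : E := if x ≤ 1 then a x else b (x - 1)

lemma cat_cont {X : Type} [TopologicalSpace X] {a b : X → ℝ → E} {r : X → ℝ}
    (ha : Continuous fun q : X × ℝ => a q.1 q.2) (hb : Continuous fun q : X × ℝ => b q.1 q.2)
    (hr : Continuous r) (hab : ∀ x, a x 1 = b x 0) :
    Continuous fun q => cat (a q) (b q) (r q) := by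
  unfold cat
  refine Continuous.if_le (f' := fun q => a q (r q)) (g' := fun q => b q (r q - 1)) ?_ ?_ hr
    continuous_const ?_
  · exact ha.comp (continuous_id.prodMk hr)
  · exact hb.comp (continuous_id.prodMk (hr.sub continuous_const))
  · intro x hx
    simp only [hx, hab, sub_self]

abbrev PP (p : C(E, B)) (b₀ : B) (e₀ : E) : Type := {w : C(I, E) // w 0 = e₀ ∧ p (w 1) = b₀}
abbrev FF (p : C(E, B)) (b₀ : B) : Type := {e : E // p e = b₀}

section second
variable {p : C(E, B)} {b₀ : B} {e₀ : E}

def fin (w : PP p b₀ e₀) : FF p b₀ := ⟨w.1 1, w.2.2⟩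

lemma fin_cont : Continuous (fin : PP p b₀ e₀ → FF p b₀) := by
  unfold fin
  fun_prop

variable (h : C(I × FF p b₀, E)) 

noncomputable def L (w : PP p b₀ e₀) : ℝ → E :=
  cat (fun x => w.1 (pr x)) (fun y => h (pr y, fin w))
noncomputable def M (z : FF p b₀ × Path e₀ e₀) : ℝ → E :=
  cat (fun x => z.2 (pr x)) (fun y => h (pr (1 - y), z.1))

variable (h0 : ∀ f, h (0, f) = f.1) (h1 : ∀ f, h (1, f) = e₀)

include h0 in
lemma L_cont {X : Type} [TopologicalSpace X] {s : X → PP p b₀ e₀} {r : X → ℝ}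
    (hs : Continuous s) (hr : Continuous r) : Continuous fun q => L h (s q) (r q) := by
  unfold L
  refine cat_cont (a := fun q x => (s q).1 (pr x)) (b := fun q y => h (pr y, fin (s q)))
    ?_ ?_ hr ?_
  · have := cpr
    have hs' : Continuous fun q : X × ℝ => (s q.1).1 := by fun_prop
    exact continuous_eval.comp (hs'.prodMk (cpr.comp continuous_snd))
  · exact h.continuous.comp ((cpr.comp continuous_snd).prodMk
      (fin_cont.comp (hs.comp continuous_fst)))
  · intro x
    simp only [pr_ge le_rfl, pr_le le_rfl, h0]; rfl

include h1 in
lemma M_cont {X : Type} [TopologicalSpace X] {s : X → FF p b₀ × Path e₀ e₀} {r : X → ℝ}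
    (hs : Continuous s) (hr : Continuous r) : Continuous fun q => M h (s q) (r q) := by
  unfold M
  refine cat_cont (a := fun q x => (s q).2 (pr x)) (b := fun q y => h (pr (1 - y), (s q).1))
    ?_ ?_ hr ?_
  · have hs' : Continuous fun q : X × ℝ => (s q.1).2 := by fun_prop
    exact continuous_eval.comp (hs'.prodMk (cpr.comp continuous_snd))
  · exact h.continuous.comp ((cpr.comp (by fun_prop)).prodMk (by fun_prop))
  · intro x
    simp only [pr_ge le_rfl, sub_zero, h1, Path.target]

lemma L_zero (w : PP p b₀ e₀) : L h w 0 = e₀ := by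
  simp [L, cat, w.2.1]
lemma L_one (w : PP p b₀ e₀) : L h w 1 = w.1 1 := by
  simp [L, cat]
include h1 in
lemma L_two (w : PP p b₀ e₀) : L h w 2 = e₀ := by
  have : pr (2 - 1) = 1 := pr_ge (by norm_num)
  simp only [L, cat, this, h1]; norm_num
lemma L_coe (w : PP p b₀ e₀) (u : I) : L h w u = w.1 u := by
  simp only [L, cat, u.2.2, if_true, pr_coe]
lemma M_zero (z : FF p b₀ × Path e₀ e₀) : M h z 0 = e₀ := by
  simp [M, cat]
lemma M_one (z : FF p b₀ × Path e₀ e₀) : M h z 1 = e₀ := by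
  simp [M, cat]
include h0 in
lemma M_two (z : FF p b₀ × Path e₀ e₀) : M h z 2 = z.1.1 := by
  have : pr (1 - (2 - 1)) = 0 := pr_le (by norm_num)
  simp only [M, cat, this, h0]; norm_num
lemma M_coe (z : FF p b₀ × Path e₀ e₀) (u : I) : M h z u = z.2 u := by
  simp only [M, cat, u.2.2, if_true, pr_coe]

noncomputable def A : C(PP p b₀ e₀, FF p b₀ × Path e₀ e₀) where
  toFun w := (fin w,
    { toFun := fun u => L h w (2 * u)
      continuous_toFun := L_cont h h0 continuous_const (by fun_prop)
      source' := by simp [L_zero]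
      target' := by simp [L_two h h1] })
  continuous_toFun := by
    refine fin_cont.prodMk (Path.continuous_uncurry_iff.1 ?_)
    exact L_cont h h0 (s := fun q : PP p b₀ e₀ × I => q.1) (r := fun q => 2 * (q.2 : ℝ))
      (by fun_prop) (by fun_prop)

noncomputable def Bk : C(FF p b₀ × Path e₀ e₀, PP p b₀ e₀) where
  toFun z := ⟨⟨fun u => M h z (2 * u), M_cont h h1 continuous_const (by fun_prop)⟩,
    by simp [M_zero], by simp [M_two h h0, z.1.2]⟩
  continuous_toFun := by
    refine Continuous.subtype_mk (ContinuousMap.continuous_of_continuous_uncurry _ ?_) _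
    exact M_cont h h1 (s := fun q : (FF p b₀ × Path e₀ e₀) × I => q.1)
      (r := fun q => 2 * (q.2 : ℝ)) (by fun_prop) (by fun_prop)

noncomputable def th (s u : I) : ℝ := (1 - s) * min (4 * (u : ℝ)) (3 - 2 * u) + s * u

lemma th_cont : Continuous fun q : I × I => th q.1 q.2 := by unfold th; fun_prop
lemma th_s0 (s : I) : th s 0 = 0 := by simp [th]
lemma th_s1 (s : I) : th s 1 = 1 := by
  simp only [th, Set.Icc.coe_one]; rw [min_eq_right (by norm_num)]; ring
lemma th_1 (u : I) : th 1 u = u := by simp [th]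
lemma th_0_le (u : I) (hu : 2 * (u : ℝ) ≤ 1) : th 0 u = 4 * u := by
  simp only [th, Set.Icc.coe_zero]; rw [min_eq_left (by linarith)]; ring
lemma th_0_ge (u : I) (hu : ¬ 2 * (u : ℝ) ≤ 1) : th 0 u = 3 - 2 * u := by
  simp only [th, Set.Icc.coe_zero]; rw [min_eq_right (by linarith)]; ring

include h0 in
lemma BA (w : PP p b₀ e₀) (u : I) : L h w (th 0 u) = ((Bk h h0 h1) (A h h0 h1 w)).1 u := by
  change _ = M h (A h h0 h1 w) (2 * u)
  by_cases hu : 2 * (u : ℝ) ≤ 1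
  · rw [th_0_le u hu, M, cat, if_pos hu]
    change _ = L h w (2 * ((pr (2 * (u : ℝ)) : I) : ℝ))
    rw [pr_val (by linarith [u.2.1]) hu]
    congr 1; ring
  · rw [th_0_ge u hu, M, cat, if_neg hu]
    have hu1 : (u : ℝ) ≤ 1 := u.2.2
    change _ = h (pr (1 - (2 * (u : ℝ) - 1)), fin w)
    rcases hu1.eq_or_lt with hh | hh
    · rw [hh]; norm_num
      rw [L_one, h0]; rfl
    · rw [L, cat, if_neg (by linarith)]
      congr 3; ring

lemma AB_snd (z : FF p b₀ × Path e₀ e₀) (u : I) :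
    M h z (th 0 u) = (A h h0 h1 (Bk h h0 h1 z)).2 u := by
  change _ = L h (Bk h h0 h1 z) (2 * u)
  have hf : fin (Bk h h0 h1 z) = z.1 := by
    apply Subtype.ext
    change M h z (2 * ((1 : I) : ℝ)) = _
    simp [M_two h h0]
  by_cases hu : 2 * (u : ℝ) ≤ 1
  · rw [th_0_le u hu, L, cat, if_pos hu]
    change _ = M h z (2 * ((pr (2 * (u : ℝ)) : I) : ℝ))
    rw [pr_val (by linarith [u.2.1]) hu]
    congr 1; ring
  · rw [th_0_ge u hu, L, cat, if_neg hu, hf]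
    have hu1 : (u : ℝ) ≤ 1 := u.2.2
    rcases hu1.eq_or_lt with hh | hh
    · rw [hh]; norm_num
      rw [M_one, h1]
    · rw [M, cat, if_neg (by linarith)]
      congr 3; ring

lemma AB_fst (z : FF p b₀ × Path e₀ e₀) : (A h h0 h1 (Bk h h0 h1 z)).1 = z.1 := by
  apply Subtype.ext
  change M h z (2 * ((1 : I) : ℝ)) = _
  simp [M_two h h0]

noncomputable def H1 :
    ContinuousMap.Homotopy ((Bk h h0 h1).comp (A h h0 h1)) (ContinuousMap.id (PP p b₀ e₀)) where
  toFun q := ⟨⟨fun u => L h q.2 (th q.1 u), L_cont h h0 continuous_const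
      (th_cont.comp (by fun_prop : Continuous fun u : I => (q.1, u)))⟩,
    by simp [th_s0, L_zero], by simp [th_s1, L_one, q.2.2.2]⟩
  continuous_toFun := by
    refine Continuous.subtype_mk (ContinuousMap.continuous_of_continuous_uncurry _ ?_) _
    exact L_cont h h0 (s := fun q : (I × PP p b₀ e₀) × I => q.1.2)
      (r := fun q => th q.1.1 q.2) (by fun_prop)
      (th_cont.comp (by fun_prop : Continuous fun q : (I × PP p b₀ e₀) × I => (q.1.1, q.2)))
  map_zero_left w := by
    apply Subtype.ext; ext u; exact BA h h0 h1 w u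
  map_one_left w := by
    apply Subtype.ext; ext u
    change L h w (th 1 u) = _
    rw [th_1, L_coe]; rfl

noncomputable def H2 :
    ContinuousMap.Homotopy ((A h h0 h1).comp (Bk h h0 h1))
      (ContinuousMap.id (FF p b₀ × Path e₀ e₀)) where
  toFun q := (q.2.1,
    { toFun := fun u => M h q.2 (th q.1 u)
      continuous_toFun := M_cont h h1 continuous_const
        (th_cont.comp (by fun_prop : Continuous fun u : I => (q.1, u)))
      source' := by simp [th_s0, M_zero]
      target' := by simp [th_s1, M_one] })
  continuous_toFun := by
    refine (by fun_prop : Continuous fun q : I × (FF p b₀ × Path e₀ e₀) => q.2.1).prodMk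
      (Path.continuous_uncurry_iff.1 ?_)
    exact M_cont h h1 (s := fun q : (I × (FF p b₀ × Path e₀ e₀)) × I => q.1.2)
      (r := fun q => th q.1.1 q.2) (by fun_prop)
      (th_cont.comp (by fun_prop :
        Continuous fun q : (I × (FF p b₀ × Path e₀ e₀)) × I => (q.1.1, q.2)))
  map_zero_left z := by
    refine Prod.ext (AB_fst h h0 h1 z).symm ?_
    ext u; exact AB_snd h h0 h1 z u
  map_one_left z := by
    refine Prod.ext rfl ?_
    ext u
    change M h z (th 1 u) = _
    rw [th_1, M_coe]; rfl

noncomputable def equiv2 : ContinuousMap.HomotopyEquiv (PP p b₀ e₀) (FF p b₀ × Path e₀ e₀) where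
  toFun := A h h0 h1
  invFun := Bk h h0 h1
  left_inv := ⟨H1 h h0 h1⟩
  right_inv := ⟨H2 h h0 h1⟩

end second

section first
variable (p : C(E, B)) (b₀ : B) (e₀ : E) (he : p e₀ = b₀)

abbrev ZZ : Type := {z : E × C(I, B) // z.2 0 = p z.1}

lemma equiv1 (hp : IsHurewiczFibration p) (he : p e₀ = b₀) :
    Nonempty (ContinuousMap.HomotopyEquiv (Path b₀ b₀) (PP p b₀ e₀)) := by
  obtain ⟨G, hG0, hG⟩ := hp (ZZ p) inferInstance ⟨fun z => z.1.1, by fun_prop⟩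
    ⟨fun q => q.1.1.2 q.2, by fun_prop⟩ (fun z => z.2)
  replace hG0 : ∀ z, G (z, 0) = z.1.1 := hG0
  replace hG : ∀ q, p (G q) = q.1.1.2 q.2 := hG
  -- base-path map
  let P : C(PP p b₀ e₀, Path b₀ b₀) :=
    { toFun := fun w =>
        { toFun := fun u => p (w.1 u)
          continuous_toFun := by fun_prop
          source' := by simp [w.2.1, he]
          target' := w.2.2 }
      continuous_toFun := Path.continuous_uncurry_iff.1 (by
        change Continuous fun q : PP p b₀ e₀ × I => p (q.1.1 q.2)
        fun_prop) }
  let j : Path b₀ b₀ → ZZ p := fun ω => ⟨(e₀, ω.toContinuousMap), by simp [he]⟩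
  have hj : Continuous j := Continuous.subtype_mk
    (continuous_const.prodMk continuous_induced_dom) _
  let S : C(Path b₀ b₀, PP p b₀ e₀) :=
    { toFun := fun ω => ⟨⟨fun u => G (j ω, u), by fun_prop⟩, hG0 _, by
        change p (G (j ω, 1)) = b₀
        rw [hG]; exact ω.target⟩
      continuous_toFun := by
        refine Continuous.subtype_mk (ContinuousMap.continuous_of_continuous_uncurry _ ?_) _
        change Continuous fun q : Path b₀ b₀ × I => G (j q.1, q.2)
        fun_prop }
  have hPS : P.comp S = ContinuousMap.id _ := by
    ext ω u
    change p (G (j ω, u)) = _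
    rw [hG]; rfl
  -- the truncated lift
  let k : PP p b₀ e₀ × ℝ → ZZ p := fun q =>
    ⟨(q.1.1 (pr q.2), ⟨fun v => p (q.1.1 (pr ((pr q.2 : I) + (v : ℝ)))),
      p.continuous.comp (q.1.1.continuous.comp (cpr.comp (by fun_prop)))⟩), by
        simp only [ContinuousMap.coe_mk, Set.Icc.coe_zero, add_zero, pr_coe]⟩
  have hk : Continuous k := by
    refine Continuous.subtype_mk (Continuous.prodMk ?_ ?_) _
    · exact continuous_eval.comp ((continuous_subtype_val.comp continuous_fst).prodMk
        (cpr.comp continuous_snd))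
    · refine ContinuousMap.continuous_of_continuous_uncurry _ ?_
      change Continuous fun q : (PP p b₀ e₀ × ℝ) × I =>
        p (q.1.1.1 (pr ((pr q.1.2 : I) + (q.2 : ℝ))))
      have c1 : Continuous fun q : (PP p b₀ e₀ × ℝ) × I => pr ((pr q.1.2 : I) + (q.2 : ℝ)) := by
        have := cpr
        exact cpr.comp ((continuous_subtype_val.comp (cpr.comp (by fun_prop))).add (by fun_prop))
      have c2 : Continuous fun q : (PP p b₀ e₀ × ℝ) × I => q.1.1.1 := by fun_prop
      exact p.continuous.comp (continuous_eval.comp (c2.prodMk c1))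
  let T : I → PP p b₀ e₀ → I → E := fun t w u =>
    G (k (w, min (u : ℝ) t), pr ((u : ℝ) - min (u : ℝ) t))
  have hT : Continuous fun q : (I × PP p b₀ e₀) × I => T q.1.1 q.1.2 q.2 := by
    refine G.continuous.comp (Continuous.prodMk (hk.comp ?_) (cpr.comp ?_)) <;> fun_prop
  have hpT : ∀ t w u, p (T t w u) = p (w.1 u) := by
    intro t w u
    simp only [T, hG]
    change p (w.1 (pr ((pr (min (u:ℝ) t) : I) + ((pr ((u:ℝ) - min (u:ℝ) t) : I) : ℝ)))) = _
    have a1 : (0:ℝ) ≤ min (u:ℝ) t := le_min u.2.1 t.2.1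
    have a2 : min (u:ℝ) t ≤ u := min_le_left _ _
    have a3 : (u : ℝ) ≤ 1 := u.2.2
    rw [pr_val a1 (by linarith), pr_val (by linarith) (by linarith), add_sub_cancel, pr_coe]
  have hT0 : ∀ t w, T t w 0 = e₀ := by
    intro t w
    have : min (((0:I):ℝ)) t = 0 := min_eq_left t.2.1
    simp only [T, this]
    rw [pr_le (by simp), hG0]
    change w.1 (pr 0) = _
    rw [pr_le le_rfl, w.2.1]
  let K : ContinuousMap.Homotopy (S.comp P) (ContinuousMap.id (PP p b₀ e₀)) :=
    { toFun := fun q => ⟨⟨fun u => T q.1 q.2 u,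
        hT.comp (by fun_prop : Continuous fun u : I => (q, u))⟩, hT0 _ _, by
          change p (T _ _ _) = _
          rw [hpT, q.2.2.2]⟩
      continuous_toFun := by
        refine Continuous.subtype_mk (ContinuousMap.continuous_of_continuous_uncurry _ ?_) _
        exact hT
      map_zero_left := by
        intro w
        apply Subtype.ext; ext u
        change T 0 w u = G (j (P w), u)
        have : min (u:ℝ) ((0:I):ℝ) = 0 := min_eq_right u.2.1
        simp only [T, this, sub_zero, pr_coe]
        congr 2
        apply Subtype.ext
        refine Prod.ext ?_ ?_
        · change w.1 (pr 0) = e₀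
          rw [pr_le le_rfl, w.2.1]
        · ext v
          change p (w.1 (pr ((pr 0 : I) + (v : ℝ)))) = p (w.1 v)
          rw [pr_le le_rfl, Set.Icc.coe_zero, zero_add, pr_coe]
      map_one_left := by
        intro w
        apply Subtype.ext; ext u
        change T 1 w u = w.1 u
        have : min (u:ℝ) ((1:I):ℝ) = u := min_eq_left u.2.2
        simp only [T, this, sub_self]
        rw [pr_le le_rfl, hG0]
        change w.1 (pr u) = _
        rw [pr_coe] }
  exact ⟨⟨S, P, hPS ▸ ContinuousMap.Homotopic.refl _, ⟨K⟩⟩⟩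

end first

end Stmt7

/-- Let `F ↪ E → B` be a fibration of pointed path-connected spaces, where
`F = p⁻¹(b₀)` is the fibre, such that the inclusion `F ↪ E` is null homotopic. Then the loop
space `ΩB` is homotopy equivalent to `F × ΩE`. -/
theorem stmt_7 {E B : Type} [TopologicalSpace E] [TopologicalSpace B]
    [PathConnectedSpace E] [PathConnectedSpace B]
    (p : C(E, B)) (hp : IsHurewiczFibration p) (b₀ : B) (e₀ : E) (he : p e₀ = b₀)
    (hnull : Nonempty (ContinuousMap.Homotopy
      (⟨Subtype.val, continuous_subtype_val⟩ : C({e : E // p e = b₀}, E))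
      (ContinuousMap.const _ e₀))) :
    Nonempty (ContinuousMap.HomotopyEquiv (Path b₀ b₀)
      ({e : E // p e = b₀} × Path e₀ e₀)) := by
  obtain ⟨h⟩ := hnull
  obtain ⟨e1⟩ := Stmt7.equiv1 p b₀ e₀ hp he
  exact ⟨e1.trans (Stmt7.equiv2 h.toContinuousMap (fun f => h.map_zero_left f)
    (fun f => h.map_one_left f))⟩
end

section
/- Let X be a connected topological manifold without boundary of dimension d, and let n ≥ 1. Then the inclusion i_n : F_n(X) ↪ X^n of the n-th configuration space into the n-fold product is (d−1)-connected, i.e., it induces isomorphisms on π_j for j ≤ d−2 and a surjection on π_{d−1}. -/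
open scoped unitInterval Topology

noncomputable section

/-- Composition of a generalized loop with a pointed continuous map. -/
def gcomp {X Y : Type} [TopologicalSpace X] [TopologicalSpace Y] {N : Type} {x : X} {y : Y}
    (f : C(X, Y)) (h : f x = y) (γ : GenLoop N X x) : GenLoop N Y y :=
  ⟨f.comp γ.1, fun t ht => by
    simp only [ContinuousMap.comp_apply]
    rw [γ.2 t ht, h]⟩

theorem gcomp_homotopic {X Y N : Type} [TopologicalSpace X] [TopologicalSpace Y] {x : X} {y : Y}
    (f : C(X, Y)) (h : f x = y) {γ₁ γ₂ : GenLoop N X x} (hγ : GenLoop.Homotopic γ₁ γ₂) :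
    GenLoop.Homotopic (gcomp f h γ₁) (gcomp f h γ₂) :=
  hγ.map fun H => H.compContinuousMap f

/-- The map induced on homotopy groups (as a plain function) by a pointed continuous map;
for `N = Fin 1` it is the induced map on fundamental groups. -/
def piMap {X Y : Type} [TopologicalSpace X] [TopologicalSpace Y] (N : Type) {x : X} {y : Y}
    (f : C(X, Y)) (h : f x = y) : HomotopyGroup N X x → HomotopyGroup N Y y :=
  Quotient.map (gcomp f h) fun _ _ hγ => gcomp_homotopic f h hγ

/-- The `n`-th configuration space of `X`: tuples of `n` pairwise-distinct points of `X`,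
topologized as a subspace of `X^n`. -/
abbrev Conf (n : ℕ) (X : Type) [TopologicalSpace X] : Type :=
  {q : Fin n → X // Function.Injective q}

open Set Filter Topology

/-- Maps to `E` can be approximated by nowhere vanishing maps. -/
def AvoidZero (D E : Type) [TopologicalSpace D] [CompactSpace D] [NormedAddCommGroup E] : Prop :=
  ∀ (h : C(D, E)) (ε : ℝ), 0 < ε → ∃ w : C(D, E), ‖w - h‖ < ε ∧ ∀ t, w t ≠ 0

theorem avoidZero_of_embedding {D V E : Type} [TopologicalSpace D] [CompactSpace D]
    [NormedAddCommGroup V] [NormedSpace ℝ V] [FiniteDimensional ℝ V]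
    [NormedAddCommGroup E] [NormedSpace ℝ E] [FiniteDimensional ℝ E]
    (i : D → V) (hi : IsClosedEmbedding i)
    (hd : Module.finrank ℝ V < Module.finrank ℝ E) : AvoidZero D E := by
  intro h ε hε
  haveI : TietzeExtension.{0} E := TietzeExtension.of_tvs ℝ
  obtain ⟨H, hH⟩ := ContinuousMap.exists_extension hi h
  obtain ⟨p, hp, hpH, -⟩ := H.continuous.exists_contDiff_approx 1
    (ε := fun _ => ε / 4) continuous_const (fun _ => by positivity)
  have hdense := ContDiff.dense_compl_range_of_finrank_lt_finrank hp hd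
  obtain ⟨v, hv, hv0⟩ := hdense.exists_dist_lt (0 : E) (ε := ε / 4) (by positivity)
  refine ⟨⟨fun t => p (i t) - v, by
    have := hp.continuous; have := hi.continuous; fun_prop⟩, ?_, ?_⟩
  · have : ‖_‖ ≤ ε / 2 := (ContinuousMap.norm_le
      ((⟨fun t => p (i t) - v, by
        have := hp.continuous; have := hi.continuous; fun_prop⟩ : C(D, E)) - h)
        (by positivity)).2 (fun t => by
      have h1 := hpH (i t)
      have h2 : H (i t) = h t := by rw [← hH]; rfl
      rw [h2, dist_eq_norm] at h1
      rw [dist_zero_left] at hv0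
      calc ‖(p (i t) - v) - h t‖ = ‖(p (i t) - h t) - v‖ := by congr 1; abel
        _ ≤ ‖p (i t) - h t‖ + ‖v‖ := norm_sub_le _ _
        _ ≤ ε / 2 := by linarith)
    linarith
  · intro t h0
    exact hv ⟨i t, sub_eq_zero.1 h0⟩

theorem exists_chart {E X : Type} [TopologicalSpace X] [NormedAddCommGroup E]
    [InnerProductSpace ℝ E] [ChartedSpace E X] (x : X) :
    ∃ e : OpenPartialHomeomorph X E, x ∈ e.source ∧ e.target = univ := by
  let c := chartAt E x
  obtain ⟨r, hr, hsub⟩ := Metric.isOpen_iff.1 c.open_target (c x) (mem_chart_target E x)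
  let b : OpenPartialHomeomorph E E := OpenPartialHomeomorph.univBall (c x) r
  refine ⟨c.trans b.symm, ?_, ?_⟩
  · rw [OpenPartialHomeomorph.trans_source]
    refine ⟨mem_chart_source E x, ?_⟩
    simp [b, OpenPartialHomeomorph.univBall_target _ hr, hr, c]
  · rw [OpenPartialHomeomorph.trans_target]
    simp only [b, OpenPartialHomeomorph.symm_target, OpenPartialHomeomorph.univBall_source,
      univ_inter, OpenPartialHomeomorph.symm_symm]
    ext y
    simp only [mem_preimage, mem_univ, iff_true]
    apply hsub
    rw [← OpenPartialHomeomorph.univBall_target (E := E) _ hr]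
    exact (OpenPartialHomeomorph.univBall (c x) r).map_source (by simp)

theorem single_step {E X D : Type} [TopologicalSpace X] [NormedAddCommGroup E]
    [InnerProductSpace ℝ E] [FiniteDimensional ℝ E]
    [TopologicalSpace D] [CompactSpace D] [T2Space D]
    (hav : AvoidZero D E) (B : Set D) (hB : IsClosed B) {n : ℕ} (a b : Fin n) (hab : a ≠ b)
    (e : OpenPartialHomeomorph X E) (he : e.target = univ)
    (f : C(D, Fin n → X)) (K : Set D) (hK : IsCompact K) (hKB : K ⊆ Bᶜ)
    (hfa : ∀ t ∈ K, f t a ∈ e.source) (hfb : ∀ t ∈ K, f t b ∈ e.source)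
    (N : Set C(D, Fin n → X)) (hN : N ∈ 𝓝 f) :
    ∃ g ∈ N, f.HomotopicRel g B ∧ ∀ t ∈ K, g t a ≠ g t b := by
  classical
  have hcfa : Continuous fun t => f t a := (continuous_apply a).comp f.continuous
  have hcfb : Continuous fun t => f t b := (continuous_apply b).comp f.continuous
  have hsymm : Continuous e.symm := by
    have := e.continuousOn_symm
    rwa [he, continuousOn_univ] at this
  let V : Set D := Bᶜ ∩ (fun t => f t a) ⁻¹' e.source
  have hV : IsOpen V := hB.isOpen_compl.inter (e.open_source.preimage hcfa)
  obtain ⟨φ, hφV, hφ1, -⟩ := exists_tsupport_one_of_isOpen_isClosed hV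
    isClosed_closure.isCompact hK.isClosed (fun t ht => ⟨hKB ht, hfa t ht⟩)
  have hφ0 : ∀ t, t ∉ V → φ t = 0 := fun t ht => image_eq_zero_of_notMem_tsupport
    (fun h => ht (hφV h))
  let P : C(D, E) × D → X := fun q =>
    if q.2 ∈ V then e.symm (e (f q.2 a) + φ q.2 • q.1 q.2) else f q.2 a
  have hPz : ∀ u t, φ t = 0 → P (u, t) = f t a := by
    intro u t h0
    simp only [P, h0, zero_smul, add_zero]
    split_ifs with h
    · exact e.left_inv h.2
    · rfl
  have hP : Continuous P := by
    rw [continuous_iff_continuousAt]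
    rintro ⟨u, t⟩
    by_cases ht : t ∈ V
    · have hev : P =ᶠ[𝓝 (u, t)] fun q => e.symm (e (f q.2 a) + φ q.2 • q.1 q.2) := by
        filter_upwards [(hV.preimage continuous_snd).mem_nhds ht] with q hq
        exact if_pos hq
      refine ContinuousAt.congr ?_ hev.symm
      refine hsymm.continuousAt.comp ?_
      refine ContinuousAt.add ?_ ?_
      · have h1 : ContinuousAt e (f t a) := e.continuousAt ht.2
        exact ContinuousAt.comp (f := fun q : C(D, E) × D => f q.2 a) h1
          (hcfa.comp continuous_snd).continuousAt
      · have : Continuous fun q : C(D, E) × D => φ q.2 • q.1 q.2 := by fun_prop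
        exact this.continuousAt
    · have hev : P =ᶠ[𝓝 (u, t)] fun q => f q.2 a := by
        have ho : IsOpen (tsupport φ)ᶜ := (isClosed_tsupport φ).isOpen_compl
        filter_upwards [(ho.preimage continuous_snd).mem_nhds
          (show (u, t) ∈ _ from fun h => ht (hφV h))] with q hq
        exact hPz _ _ (image_eq_zero_of_notMem_tsupport hq)
      exact ContinuousAt.congr (hcfa.comp continuous_snd).continuousAt hev.symm
  let F : C(C(D, E) × D, Fin n → X) := ⟨fun q => Function.update (f q.2) a (P q),
    (f.continuous.comp continuous_snd).update a hP⟩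
  let G : C(C(D, E), C(D, Fin n → X)) := F.curry
  have hGz : ∀ u t, φ t = 0 ∨ u t = 0 → G u t = f t := by
    intro u t h0
    show Function.update (f t) a (P (u, t)) = f t
    have : P (u, t) = f t a := by
      rcases h0 with h0 | h0
      · exact hPz u t h0
      · by_cases ht : t ∈ V
        · simp only [P, if_pos ht, h0, smul_zero, add_zero]
          exact e.left_inv ht.2
        · exact hPz u t (hφ0 t ht)
    rw [this, Function.update_eq_self]
  have hG0 : G 0 = f := by
    ext1 t
    exact hGz 0 t (Or.inr rfl)
  have hnear : G ⁻¹' N ∈ 𝓝 (0 : C(D, E)) := G.continuous.continuousAt.preimage_mem_nhds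
    (by rwa [hG0])
  obtain ⟨ε, hε, hball⟩ := Metric.mem_nhds_iff.1 hnear
  haveI : TietzeExtension.{0} E := TietzeExtension.of_tvs ℝ
  let h0 : C(K, E) := ⟨fun t => e (f t a) - e (f t b), by
    refine Continuous.sub ?_ ?_
    · exact e.continuousOn.comp_continuous (hcfa.comp continuous_subtype_val)
        (fun t => hfa t t.2)
    · exact e.continuousOn.comp_continuous (hcfb.comp continuous_subtype_val)
        (fun t => hfb t t.2)⟩
  obtain ⟨h, hh⟩ := ContinuousMap.exists_restrict_eq hK.isClosed h0
  obtain ⟨w, hw, hw0⟩ := hav h ε hε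
  refine ⟨G (w - h), hball (by simpa using hw), ?_, ?_⟩
  · refine ⟨⟨⟨⟨fun q => F ((q.1 : ℝ) • (w - h), q.2), ?_⟩, ?_, ?_⟩, ?_⟩⟩
    · fun_prop
    · intro t
      show G (((0 : I) : ℝ) • (w - h)) t = f t
      simp [hG0]
    · intro t
      show G (((1 : I) : ℝ) • (w - h)) t = G (w - h) t
      simp
    · intro s t ht
      exact hGz ((s : ℝ) • (w - h)) t (Or.inl (hφ0 t fun h => h.1 ht))
  · intro t ht heq
    have htV : t ∈ V := ⟨hKB ht, hfa t ht⟩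
    have h1 : G (w - h) t a = e.symm (e (f t a) + φ t • (w - h) t) := by
      show Function.update (f t) a (P (w - h, t)) a = _
      simp only [Function.update_self, P, if_pos htV]
    have h2 : G (w - h) t b = f t b := by
      show Function.update (f t) a (P (w - h, t)) b = _
      rw [Function.update_of_ne hab.symm]
    have h3 : h t = e (f t a) - e (f t b) := DFunLike.congr_fun hh ⟨t, ht⟩
    have h4 : φ t = 1 := hφ1 ht
    rw [h1, h2] at heq
    have h5 := congrArg e heq
    rw [e.right_inv (by rw [he]; trivial), h4, one_smul, ContinuousMap.sub_apply, h3] at h5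
    apply hw0 t
    have : w t = (e (f t a) + (w t - (e (f t a) - e (f t b)))) - e (f t b) := by abel
    rw [this, h5, sub_self]

theorem eventually_ne {X D : Type} [TopologicalSpace X] [T2Space X] [TopologicalSpace D]
    {n : ℕ} (a b : Fin n) (f : C(D, Fin n → X)) (K : Set D) (hK : IsCompact K)
    (h : ∀ t ∈ K, f t a ≠ f t b) :
    ∀ᶠ g : C(D, Fin n → X) in 𝓝 f, ∀ t ∈ K, g t a ≠ g t b :=
  ContinuousMap.eventually_mapsTo (U := {q : Fin n → X | q a ≠ q b}) hK
    (isOpen_ne_fun (continuous_apply a) (continuous_apply b)) h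

theorem pair_step {E X D : Type} [TopologicalSpace X] [T2Space X] [NormedAddCommGroup E]
    [InnerProductSpace ℝ E] [FiniteDimensional ℝ E] [ChartedSpace E X]
    [TopologicalSpace D] [CompactSpace D] [T2Space D]
    (hav : AvoidZero D E) (B : Set D) (hB : IsClosed B) {n : ℕ} (a b : Fin n) (hab : a ≠ b)
    (f : C(D, Fin n → X)) (hfB : ∀ t ∈ B, f t a ≠ f t b)
    (N : Set C(D, Fin n → X)) (hN : N ∈ 𝓝 f) :
    ∃ g ∈ N, f.HomotopicRel g B ∧ ∀ t, g t a ≠ g t b := by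
  have hcfa : Continuous fun t => f t a := (continuous_apply a).comp f.continuous
  have hcfb : Continuous fun t => f t b := (continuous_apply b).comp f.continuous
  let p : Set D → Prop := fun S => ∃ K, IsCompact K ∧ S ⊆ K ∧
    ∀ᶠ g in 𝓝 f, ∀ M ∈ 𝓝 g, ∃ g' ∈ M, g.HomotopicRel g' B ∧ ∀ t ∈ K, g' t a ≠ g' t b
  have key : p univ := by
    refine isCompact_univ.induction_on (p := p) ?_ ?_ ?_ ?_
    · refine ⟨∅, isCompact_empty, subset_rfl, Eventually.of_forall fun g M hM => ?_⟩
      exact ⟨g, mem_of_mem_nhds hM, .refl _, by simp⟩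
    · rintro s t hst ⟨K, hK, hs, h⟩
      exact ⟨K, hK, hst.trans hs, h⟩
    · rintro s t ⟨K, hK, hs, h⟩ ⟨L, hL, ht, h'⟩
      refine ⟨K ∪ L, hK.union hL, union_subset_union hs ht, ?_⟩
      filter_upwards [h, h'.eventually_nhds] with g hg hg' M hM
      obtain ⟨g1, ⟨h1M, h1⟩, hom1, hne1⟩ := hg _ (inter_mem (eventually_mem_nhds_iff.2 hM) hg')
      obtain ⟨g2, ⟨h2M, h2⟩, hom2, hne2⟩ := h1 _
        (inter_mem h1M (eventually_ne a b g1 K hK hne1))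
      refine ⟨g2, h2M, hom1.trans hom2, ?_⟩
      rintro t (ht | ht)
      · exact h2 t ht
      · exact hne2 t ht
    · intro t _
      simp only [nhdsWithin_univ]
      by_cases ht : f t a = f t b
      · obtain ⟨e, hes, het⟩ := exists_chart (E := E) (f t a)
        have htB : t ∉ B := fun h => hfB t h ht
        have hO : Bᶜ ∩ ((fun t => f t a) ⁻¹' e.source ∩ (fun t => f t b) ⁻¹' e.source) ∈ 𝓝 t :=
          inter_mem (hB.isOpen_compl.mem_nhds htB)
            (inter_mem ((e.open_source.preimage hcfa).mem_nhds hes)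
              ((e.open_source.preimage hcfb).mem_nhds (by
                show f t b ∈ e.source
                rwa [← ht])))
        obtain ⟨K, hKt, hKO, hK⟩ := local_compact_nhds hO
        refine ⟨K, hKt, K, hK, subset_rfl, ?_⟩
        have hev := ContinuousMap.eventually_mapsTo (f := f) (K := K)
          (U := {q : Fin n → X | q a ∈ e.source ∧ q b ∈ e.source}) hK
          ((e.open_source.preimage (continuous_apply a)).inter
            (e.open_source.preimage (continuous_apply b))) (fun s hs => (hKO hs).2)
        filter_upwards [hev] with g hg M hM
        exact single_step hav B hB a b hab e het g K hK (fun s hs => (hKO hs).1)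
          (fun s hs => (hg hs).1) (fun s hs => (hg hs).2) M hM
      · have hO : {s | f s a ≠ f s b} ∈ 𝓝 t := (isOpen_ne_fun hcfa hcfb).mem_nhds ht
        obtain ⟨K, hKt, hKO, hK⟩ := local_compact_nhds hO
        refine ⟨K, hKt, K, hK, subset_rfl, ?_⟩
        filter_upwards [eventually_ne a b f K hK hKO] with g hg M hM
        exact ⟨g, mem_of_mem_nhds hM, .refl _, hg⟩
  obtain ⟨K, -, hKu, h⟩ := key
  obtain ⟨g, hg, hom, hne⟩ := h.self_of_nhds N hN
  exact ⟨g, hg, hom, fun t => hne t (hKu trivial)⟩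

theorem general_position {E X D : Type} [TopologicalSpace X] [T2Space X] [NormedAddCommGroup E]
    [InnerProductSpace ℝ E] [FiniteDimensional ℝ E] [ChartedSpace E X]
    [TopologicalSpace D] [CompactSpace D] [T2Space D]
    (hav : AvoidZero D E) (B : Set D) (hB : IsClosed B) {n : ℕ}
    (f : C(D, Fin n → X)) (hfB : ∀ t ∈ B, Function.Injective (f t)) :
    ∃ g, f.HomotopicRel g B ∧ ∀ t, Function.Injective (g t) := by
  classical
  have key : ∀ S : Finset (Fin n × Fin n), ∃ g, f.HomotopicRel g B ∧
      ∀ p ∈ S, p.1 ≠ p.2 → ∀ t, g t p.1 ≠ g t p.2 := by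
    intro S
    induction S using Finset.induction_on with
    | empty => exact ⟨f, .refl _, by simp⟩
    | insert p S _ ih =>
      obtain ⟨g, hom, hg⟩ := ih
      by_cases hp : p.1 = p.2
      · refine ⟨g, hom, fun q hq hne => ?_⟩
        rcases Finset.mem_insert.1 hq with rfl | hq
        · exact absurd hp hne
        · exact hg q hq hne
      · have hev : ∀ᶠ g' in 𝓝 g, ∀ q ∈ S, q.1 ≠ q.2 → ∀ t, g' t q.1 ≠ g' t q.2 := by
          rw [Filter.eventually_all_finset]
          intro q hq
          by_cases hne : q.1 = q.2
          · exact Eventually.of_forall fun _ h => absurd hne h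
          · filter_upwards [eventually_ne q.1 q.2 g univ isCompact_univ
              (fun t _ => hg q hq hne t)] with g' h' _ t
            exact h' t trivial
        obtain ⟨g', hg', hom', hne'⟩ := pair_step (E := E) hav B hB p.1 p.2 hp g
          (fun t ht => by
            rw [← hom.fst_eq_snd ht]
            exact fun h => hp (hfB t ht h)) _ hev
        refine ⟨g', hom.trans hom', fun q hq hne => ?_⟩
        rcases Finset.mem_insert.1 hq with rfl | hq
        · exact hne'
        · exact hg' q hq hne
  obtain ⟨g, hom, hg⟩ := key Finset.univ
  refine ⟨g, hom, fun t a b h => ?_⟩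
  by_contra hab
  exact hg (a, b) (Finset.mem_univ _) hab t h

theorem cube_embedding (k : ℕ) :
    IsClosedEmbedding (fun (t : Fin k → I) (i : Fin k) => ((t i : I) : ℝ)) := by
  refine Continuous.isClosedEmbedding (by fun_prop) ?_
  intro s t h
  ext i
  exact congrFun h i

theorem isClosed_boundary (k : ℕ) : IsClosed (Cube.boundary (Fin k)) := by
  have : Cube.boundary (Fin k) = ⋃ i : Fin k, {y | y i = 0 ∨ y i = 1} := by
    ext y
    simp [Cube.boundary]
  rw [this]
  refine isClosed_iUnion_of_finite fun i => ?_
  exact (isClosed_eq (continuous_apply i) continuous_const).union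
    (isClosed_eq (continuous_apply i) continuous_const)

theorem surj_aux {d : ℕ} {X : Type} [TopologicalSpace X] [T2Space X]
    [ChartedSpace (EuclideanSpace ℝ (Fin d)) X] (n : ℕ) (q₀ : Conf n X) (k : ℕ) (hk : k < d) :
    Function.Surjective
        (piMap (Fin k) (⟨Subtype.val, continuous_subtype_val⟩ : C(Conf n X, Fin n → X))
          (x := q₀) (y := q₀.val) rfl) := by
  intro c
  induction c using Quotient.inductionOn with
  | h γ =>
    have hav : AvoidZero (Fin k → I) (EuclideanSpace ℝ (Fin d)) :=
      avoidZero_of_embedding _ (cube_embedding k) (by simpa using hk)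
    obtain ⟨g, hom, hg⟩ := general_position hav (Cube.boundary (Fin k)) (isClosed_boundary k) γ.1
      (fun t ht => by rw [γ.2 t ht]; exact q₀.2)
    refine ⟨Quotient.mk _ ⟨⟨fun t => ⟨g t, hg t⟩, by fun_prop⟩, ?_⟩, ?_⟩
    · intro t ht
      apply Subtype.ext
      show g t = q₀.1
      rw [← hom.fst_eq_snd ht, γ.2 t ht]
    · apply Quotient.sound
      exact hom.symm

theorem inj_aux {d : ℕ} {X : Type} [TopologicalSpace X] [T2Space X]
    [ChartedSpace (EuclideanSpace ℝ (Fin d)) X] (n : ℕ) (q₀ : Conf n X) (k : ℕ) (hk : k + 1 < d) :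
    Function.Injective
        (piMap (Fin k) (⟨Subtype.val, continuous_subtype_val⟩ : C(Conf n X, Fin n → X))
          (x := q₀) (y := q₀.val) rfl) := by
  intro c₁ c₂
  induction c₁ using Quotient.inductionOn with
  | h γ₁ =>
  induction c₂ using Quotient.inductionOn with
  | h γ₂ =>
    intro heq
    obtain ⟨H⟩ := Quotient.exact heq
    have hemb : IsClosedEmbedding (fun (q : I × (Fin k → I)) =>
        (((q.1 : ℝ), fun i => ((q.2 i : I) : ℝ)) : ℝ × (Fin k → ℝ))) := by
      refine Continuous.isClosedEmbedding (by fun_prop) ?_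
      intro s t h
      refine Prod.ext (Subtype.ext (congrArg Prod.fst h)) ?_
      ext i
      exact congrFun (congrArg Prod.snd h) i
    have hav : AvoidZero (I × (Fin k → I)) (EuclideanSpace ℝ (Fin d)) :=
      avoidZero_of_embedding _ hemb (by simp; omega)
    let B : Set (I × (Fin k → I)) := {q | (q.1 = 0 ∨ q.1 = 1) ∨ q.2 ∈ Cube.boundary (Fin k)}
    have hB : IsClosed B :=
      ((isClosed_eq continuous_fst continuous_const).union
        (isClosed_eq continuous_fst continuous_const)).union
        ((isClosed_boundary k).preimage continuous_snd)
    have H0 : ∀ t, H (0, t) = (γ₁.1 t).1 := fun t => H.apply_zero t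
    have H1 : ∀ t, H (1, t) = (γ₂.1 t).1 := fun t => H.apply_one t
    have Hb : ∀ s, ∀ t ∈ Cube.boundary (Fin k), H (s, t) = (γ₁.1 t).1 :=
      fun s t ht => H.eq_fst s ht
    let f : C(I × (Fin k → I), Fin n → X) := ⟨fun q => H q, H.continuous⟩
    obtain ⟨g, hom, hg⟩ := general_position hav B hB f (by
      rintro ⟨s, t⟩ ((h | h) | h)
      · obtain rfl : s = 0 := h
        show Function.Injective (H (0, t))
        rw [H0]; exact (γ₁.1 t).2
      · obtain rfl : s = 1 := h
        show Function.Injective (H (1, t))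
        rw [H1]; exact (γ₂.1 t).2
      · show Function.Injective (H (s, t))
        rw [Hb s t h]; exact (γ₁.1 t).2)
    have hfg : ∀ q ∈ B, g q = H q := fun q hq => (hom.fst_eq_snd hq).symm
    apply Quotient.sound
    refine ⟨⟨⟨⟨fun q => ⟨g q, hg q⟩, by fun_prop⟩, ?_, ?_⟩, ?_⟩⟩
    · intro t
      apply Subtype.ext
      exact (hfg (0, t) (Or.inl (Or.inl rfl))).trans (H0 t)
    · intro t
      apply Subtype.ext
      exact (hfg (1, t) (Or.inl (Or.inr rfl))).trans (H1 t)
    · intro s t ht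
      apply Subtype.ext
      exact (hfg (s, t) (Or.inr ht)).trans (Hb s t ht)

/-- Let `X` be a connected topological manifold without boundary of dimension
`d`, and `n ≥ 1`. Then the inclusion `i_n : F_n(X) ↪ X^n` is `(d−1)`-connected: it induces
bijections on `π_j` for `j ≤ d − 2` and a surjection on `π_{d−1}`. -/
theorem stmt_11 {d : ℕ} {X : Type} [TopologicalSpace X] [T2Space X]
    [ChartedSpace (EuclideanSpace ℝ (Fin d)) X] [ConnectedSpace X]
    (n : ℕ) (hn : 1 ≤ n) (q₀ : Conf n X) :
    (∀ j : ℕ, j + 2 ≤ d →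
      Function.Bijective
        (piMap (Fin j) (⟨Subtype.val, continuous_subtype_val⟩ : C(Conf n X, Fin n → X))
          (x := q₀) (y := q₀.val) rfl)) ∧
    Function.Surjective
      (piMap (Fin (d - 1)) (⟨Subtype.val, continuous_subtype_val⟩ : C(Conf n X, Fin n → X))
        (x := q₀) (y := q₀.val) rfl) := by
  refine ⟨fun j hj => ⟨inj_aux (d := d) n q₀ j (by omega), surj_aux (d := d) n q₀ j (by omega)⟩, ?_⟩
  rcases Nat.eq_zero_or_pos d with rfl | hd
  · haveI : DiscreteTopology X := ChartedSpace.discreteTopology (EuclideanSpace ℝ (Fin 0)) X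
    haveI : Subsingleton X := PreconnectedSpace.trivial_of_discrete
    intro c
    induction c using Quotient.inductionOn with
    | h γ =>
      refine ⟨Quotient.mk _ GenLoop.const, ?_⟩
      refine congrArg (Quotient.mk _) ?_
      apply Subtype.ext
      ext1 t
      exact Subsingleton.elim _ _
  · exact surj_aux (d := d) n q₀ (d - 1) (by omega)
end
end

section
/- Let G be a nontrivial finite group acting freely by homeomorphisms on the sphere S^k with k even. Then G has order 2. -/
/-- The standard `k`-sphere, as the unit sphere in `ℝ^{k+1}`. -/
abbrev Sph (k : ℕ) : Type := Metric.sphere (0 : EuclideanSpace ℝ (Fin (k + 1))) 1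

open MeasureTheory Metric Set Topology

/-- det (1 + s A) is a polynomial in s: Lagrange interpolation. -/
lemma aux_interp {E : Type*} [NormedAddCommGroup E] [NormedSpace ℝ E] [FiniteDimensional ℝ E]
    (v : ℕ → ℝ) (hv : Function.Injective v) :
    ∃ c : ℕ → ℝ, ∀ A : E →L[ℝ] E,
      (ContinuousLinearMap.id ℝ E + A).det =
        ∑ j ∈ Finset.range (Module.finrank ℝ E + 1),
          c j * (ContinuousLinearMap.id ℝ E + v j • A).det := by
  classical
  let S := Finset.range (Module.finrank ℝ E + 1)
  refine ⟨fun j => (Lagrange.basis S v j).eval 1, fun A => ?_⟩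
  let b := Module.finBasis ℝ E
  let M := LinearMap.toMatrix b b (A : E →ₗ[ℝ] E)
  let P : Polynomial ℝ := Matrix.det ((Polynomial.X : Polynomial ℝ) • M.map Polynomial.C +
    (1 : Matrix _ _ ℝ).map Polynomial.C)
  have hP : ∀ s : ℝ, P.eval s = (ContinuousLinearMap.id ℝ E + s • A).det := by
    intro s
    have h1 : (ContinuousLinearMap.id ℝ E + s • A).det =
        Matrix.det (1 + s • M) := by
      rw [ContinuousLinearMap.det, ← LinearMap.det_toMatrix b]
      congr 1
      simp [M, map_add]
    rw [h1, ← Polynomial.coe_evalRingHom, RingHom.map_det]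
    congr 1
    ext i j
    by_cases h : i = j
    · simp [h, add_comm]; ring
    · simp [h]; ring
  have hd : P.degree < (S.card : ℕ) := by
    rw [Finset.card_range]
    refine lt_of_le_of_lt Polynomial.degree_le_natDegree ?_
    have := Polynomial.natDegree_det_X_add_C_le M 1
    rw [Fintype.card_fin] at this
    exact_mod_cast Nat.lt_succ_of_le this
  have h := Lagrange.eq_interpolate (s := S) (v := v) hv.injOn hd
  have h1 := hP 1
  rw [one_smul] at h1
  rw [← h1, h, Lagrange.interpolate_apply, Polynomial.eval_finsetSum]
  refine Finset.sum_congr rfl fun j _ => ?_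
  rw [Polynomial.eval_mul, Polynomial.eval_C, hP, mul_comm]

section
variable {E : Type*} [NormedAddCommGroup E] [NormedSpace ℝ E] [FiniteDimensional ℝ E]

lemma aux_det_pos (A : E →L[ℝ] E) (h : ‖A‖ < 1) : 0 < (ContinuousLinearMap.id ℝ E + A).det := by
  have hne : ∀ s ∈ Icc (0:ℝ) 1, (ContinuousLinearMap.id ℝ E + s • A).det ≠ 0 := by
    intro s hs h0
    have h0' : LinearMap.det ((ContinuousLinearMap.id ℝ E + s • A : E →L[ℝ] E) : E →ₗ[ℝ] E) = 0 := h0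
    obtain ⟨x, hx, hx0⟩ := (Submodule.ne_bot_iff _).1 (LinearMap.bot_lt_ker_of_det_eq_zero h0').ne'
    have hx' : x + s • A x = 0 := by simpa using hx
    have h2 : ‖x‖ = ‖s • A x‖ := by
      have := congrArg norm (eq_neg_of_add_eq_zero_left hx')
      rwa [norm_neg] at this
    have h3 : ‖s • A x‖ ≤ ‖A‖ * ‖x‖ := by
      rw [norm_smul, Real.norm_of_nonneg hs.1]
      calc s * ‖A x‖ ≤ 1 * ‖A x‖ := by gcongr; exact hs.2
        _ ≤ _ := by rw [one_mul]; exact A.le_opNorm x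
    have := norm_pos_iff.2 hx0
    nlinarith
  by_contra hneg
  push Not at hneg
  have hc : ContinuousOn (fun s : ℝ => (ContinuousLinearMap.id ℝ E + s • A).det) (Icc 0 1) := by
    apply Continuous.continuousOn
    exact ContinuousLinearMap.continuous_det.comp (by fun_prop)
  have := intermediate_value_Icc' zero_le_one hc
  have h0 : (0:ℝ) ∈ Icc ((ContinuousLinearMap.id ℝ E + (1:ℝ) • A).det) ((ContinuousLinearMap.id ℝ E + (0:ℝ) • A).det) := by
    constructor
    · simpa using hneg
    · simp [ContinuousLinearMap.det]
  obtain ⟨s, hs, h⟩ := this h0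
  exact hne s hs h

variable [MeasurableSpace E] [BorelSpace E] (μ : Measure E) [μ.IsAddHaarMeasure]

lemma aux_small (u : E → E) (hu : ContDiff ℝ 1 u) (C : NNReal) (hC : LipschitzWith C u)
    (hC1 : C < 1) (R : ℝ) (hR : ∀ x, R < ‖x‖ → u x = 0) :
    ∫ x in closedBall (0:E) R, (ContinuousLinearMap.id ℝ E + fderiv ℝ u x).det ∂μ
      = μ.real (closedBall (0:E) R) := by
  have hpos : ∀ x, 0 < (ContinuousLinearMap.id ℝ E + fderiv ℝ u x).det := fun x =>
    aux_det_pos _ (lt_of_le_of_lt (norm_fderiv_le_of_lipschitz ℝ hC) (by exact_mod_cast hC1))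
  let f : E → E := fun x => x + u x
  have hinj : Function.Injective f := by
    intro x y hxy
    have h1 : x - y = u y - u x := by
      have : x + u x = y + u y := hxy
      rw [sub_eq_sub_iff_add_eq_add, this, add_comm]
    have h2 := hC.dist_le_mul y x
    rw [dist_eq_norm, dist_eq_norm, ← h1, norm_sub_rev y x] at h2
    by_contra hne
    have h3 : 0 < ‖x - y‖ := norm_pos_iff.2 (sub_ne_zero.2 hne)
    have h4 : (C:ℝ) < 1 := by exact_mod_cast hC1
    nlinarith
  have hsurj : Function.Surjective f := by
    intro y
    have hc : ContractingWith C (fun x => y - u x) := by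
      refine ⟨hC1, LipschitzWith.of_dist_le_mul fun a b => ?_⟩
      rw [dist_sub_left]
      exact hC.dist_le_mul a b
    refine ⟨hc.fixedPoint, ?_⟩
    have := hc.fixedPoint_isFixedPt
    have h : y - u hc.fixedPoint = hc.fixedPoint := this
    show hc.fixedPoint + u hc.fixedPoint = y
    exact (sub_eq_iff_eq_add.1 h).symm
  have himg : f '' closedBall 0 R = closedBall 0 R := by
    have hout : ∀ x, R < ‖x‖ → f x = x := fun x hx => by simp [f, hR x hx]
    ext y
    constructor
    · rintro ⟨x, hx, rfl⟩
      by_contra hy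
      have hy' : R < ‖f x‖ := by simpa using hy
      have := hinj (hout _ hy')
      rw [this] at hy
      exact hy hx
    · intro hy
      obtain ⟨x, rfl⟩ := hsurj y
      refine ⟨x, ?_, rfl⟩
      by_contra hx
      have hx' : R < ‖x‖ := by simpa using hx
      rw [hout x hx'] at hy
      exact hx hy
  have hcov := integral_image_eq_integral_abs_det_fderiv_smul μ (s := closedBall (0:E) R) (f := f)
    (f' := fun x => ContinuousLinearMap.id ℝ E + fderiv ℝ u x) measurableSet_closedBall
    (fun x _ => ((hasFDerivAt_id x).add
      (hu.differentiable (by simp) x).hasFDerivAt).hasFDerivWithinAt) hinj.injOn (fun _ => (1:ℝ))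
  rw [himg] at hcov
  simp only [smul_eq_mul, mul_one, abs_of_pos (hpos _)] at hcov
  rw [← hcov]
  simp

lemma lemA (F : E → E) (hF : ContDiff ℝ 1 F) (R : ℝ) (hR : ∀ x, R < ‖x‖ → F x = x) :
    ∫ x in closedBall (0:E) R, (fderiv ℝ F x).det ∂μ = μ.real (closedBall (0:E) R) := by
  let u : E → E := fun x => F x - x
  have hu : ContDiff ℝ 1 u := hF.sub contDiff_id
  have hu0 : ∀ x, R < ‖x‖ → u x = 0 := fun x hx => by simp [u, hR x hx]
  have hcs : HasCompactSupport u := by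
    refine HasCompactSupport.intro (isCompact_closedBall (0:E) R) fun x hx => hu0 x ?_
    simpa using hx
  obtain ⟨C, hC⟩ := hu.lipschitzWith_of_hasCompactSupport hcs (by simp)
  let N := Module.finrank ℝ E + 1
  let δ : NNReal := 1 / (N * (C + 1))
  have hδ : 0 < δ := by positivity
  let v : ℕ → ℝ := fun j => j * δ
  have hv : Function.Injective v := by
    intro a b hab
    have : (δ:ℝ) ≠ 0 := by exact_mod_cast hδ.ne'
    simpa [v, this] using hab
  have hvn : ∀ j, 0 ≤ v j := fun j => mul_nonneg (Nat.cast_nonneg _) δ.coe_nonneg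
  have hP : ∀ j ∈ Finset.range N,
      ∫ x in closedBall (0:E) R, (ContinuousLinearMap.id ℝ E + v j • fderiv ℝ u x).det ∂μ
      = μ.real (closedBall (0:E) R) := by
    intro j hj
    have hj' : j < N := Finset.mem_range.1 hj
    have h := aux_small μ (fun x => v j • u x) (hu.const_smul _) ((j * δ) * C)
      (by
        refine LipschitzWith.of_dist_le_mul fun a b => ?_
        rw [dist_smul₀, Real.norm_of_nonneg (hvn j)]
        push_cast
        have := mul_le_mul_of_nonneg_left (hC.dist_le_mul a b) (hvn j)
        simpa only [v, mul_assoc] using this)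
      (by
        have : (j:NNReal) * δ * C = (j * C) / (N * (C+1)) := by simp only [δ]; ring
        rw [this, div_lt_one (by positivity)]
        have h1 : (j:NNReal) < N := by exact_mod_cast hj'
        calc (j:NNReal) * C ≤ N * C := by gcongr
          _ < N * (C+1) := by
            have : (0:NNReal) < N := by positivity
            gcongr
            exact lt_add_one C)
      R (fun x hx => by simp [hu0 x hx])
    rw [← h]
    congr 1
    ext x
    rw [fderiv_fun_const_smul (hu.differentiable (by simp) x)]
  obtain ⟨c, hc⟩ := aux_interp (E := E) v hv
  have hint : ∀ s : ℝ, IntegrableOn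
      (fun x => (ContinuousLinearMap.id ℝ E + s • fderiv ℝ u x).det) (closedBall (0:E) R) μ := by
    intro s
    refine ContinuousOn.integrableOn_compact (isCompact_closedBall _ _) (Continuous.continuousOn ?_)
    refine ContinuousLinearMap.continuous_det.comp ?_
    have := hu.continuous_fderiv (by simp)
    fun_prop
  have hFu : ∀ x, fderiv ℝ F x = ContinuousLinearMap.id ℝ E + fderiv ℝ u x := by
    intro x
    have : fderiv ℝ u x = fderiv ℝ F x - ContinuousLinearMap.id ℝ E :=
      ((hF.differentiable (by simp) x).hasFDerivAt.sub (hasFDerivAt_id x)).fderiv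
    rw [this]; abel
  have hsum : ∀ A : E →L[ℝ] E, ∑ j ∈ Finset.range N, c j = 1 := by
    intro A
    have := hc 0
    simpa [ContinuousLinearMap.det, N] using this.symm
  have hFd : ∀ x, (fderiv ℝ F x).det = ∑ j ∈ Finset.range N,
      c j * (ContinuousLinearMap.id ℝ E + v j • fderiv ℝ u x).det := fun x => by rw [hFu, hc]
  rw [integral_congr_ae (Filter.Eventually.of_forall hFd)]
  rw [integral_finsetSum _ (fun j _ => (hint (v j)).const_mul (c j))]
  simp_rw [integral_const_mul]
  rw [Finset.sum_congr rfl fun j hj => by rw [hP j hj], ← Finset.sum_mul, hsum 0, one_mul]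
end

set_option linter.unusedSectionVars false
noncomputable section
variable {E : Type*} [NormedAddCommGroup E] [InnerProductSpace ℝ E]

def bta (x : E) : ℝ := Real.smoothTransition (‖x‖^2 - 1) * Real.smoothTransition (9 - ‖x‖^2)

def clps (K : E → E) (x : E) : E := ((1 - bta x) + 2 * bta x * ‖K x‖⁻¹) • K x

lemma bta_zero_in {x : E} (h : ‖x‖^2 ≤ 1) : bta x = 0 := by
  rw [bta, Real.smoothTransition.zero_of_nonpos (by linarith), zero_mul]
lemma bta_zero_out {x : E} (h : 9 ≤ ‖x‖^2) : bta x = 0 := by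
  rw [bta, Real.smoothTransition.zero_of_nonpos (x := 9 - ‖x‖^2) (by linarith), mul_zero]
lemma bta_one {x : E} (h : 2 ≤ ‖x‖^2) (h' : ‖x‖^2 ≤ 8) : bta x = 1 := by
  rw [bta, Real.smoothTransition.one_of_one_le (by linarith),
    Real.smoothTransition.one_of_one_le (by linarith), mul_one]
lemma bta_in {x : E} (h' : ‖x‖^2 ≤ 8) : bta x = Real.smoothTransition (‖x‖^2 - 1) := by
  rw [bta, Real.smoothTransition.one_of_one_le (x := 9 - ‖x‖^2) (by linarith), mul_one]

lemma bta_contDiff : ContDiff ℝ 1 (bta (E := E)) := by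
  have h : ContDiff ℝ 1 (fun x : E => ‖x‖^2) := contDiff_norm_sq ℝ
  have hS : ContDiff ℝ 1 Real.smoothTransition := Real.smoothTransition.contDiff (n := 1)
  exact (hS.comp (h.sub contDiff_const)).mul (hS.comp (contDiff_const.sub h))

lemma isOpenLt (a : ℝ) : IsOpen {x : E | ‖x‖^2 < a} :=
  isOpen_lt (by fun_prop) continuous_const
lemma isOpenGt (a : ℝ) : IsOpen {x : E | a < ‖x‖^2} :=
  _root_.isOpen_lt continuous_const (by fun_prop)

lemma clps_contDiff (K : E → E) (hK : ContDiff ℝ 1 K) (h0 : ∀ x, x ≠ 0 → K x ≠ 0) :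
    ContDiff ℝ 1 (clps K) := by
  rw [contDiff_iff_contDiffAt]
  intro x
  by_cases hx : x = 0
  · have : clps K =ᶠ[𝓝 x] K := by
      filter_upwards [(isOpenLt (E := E) 1).mem_nhds (by simp [hx])] with y hy
      simp [clps, bta_zero_in (le_of_lt hy)]
    exact hK.contDiffAt.congr_of_eventuallyEq this
  · have hb := (bta_contDiff (E := E)).contDiffAt (x := x)
    have hn : ContDiffAt ℝ 1 (fun y => ‖K y‖) x := hK.contDiffAt.norm ℝ (h0 x hx)
    exact ((contDiffAt_const.sub hb).add ((contDiffAt_const.mul hb).mul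
      (hn.inv (norm_ne_zero_iff.2 (h0 x hx))))).smul hK.contDiffAt

lemma clps_norm (K : E → E) (h0 : ∀ x, x ≠ 0 → K x ≠ 0) {x : E}
    (h : 2 ≤ ‖x‖^2) (h' : ‖x‖^2 ≤ 8) : ‖clps K x‖ = 2 := by
  have hx : x ≠ 0 := by rintro rfl; norm_num at h
  have := norm_ne_zero_iff.2 (h0 x hx)
  rw [clps, bta_one h h', norm_smul]
  simp
  field_simp

variable [FiniteDimensional ℝ E]

lemma det_zero_of_norm (F : E → E) (x : E) (hF : DifferentiableAt ℝ F x)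
    (h : ∀ᶠ y in 𝓝 x, ‖F y‖ = 2) : (fderiv ℝ F x).det = 0 := by
  by_contra hne
  have h1 : HasFDerivAt (fun y => ‖F y‖^2) _ x := hF.hasFDerivAt.norm_sq
  have h2 : HasFDerivAt (fun y => ‖F y‖^2) (0 : E →L[ℝ] ℝ) x := by
    refine (hasFDerivAt_const (4:ℝ) x).congr_of_eventuallyEq ?_
    filter_upwards [h] with y hy
    rw [hy]; norm_num
  have h3 := h1.unique h2
  have hsurj : Function.Surjective (fderiv ℝ F x) := by
    have := LinearMap.equivOfDetNeZero (fderiv ℝ F x : E →ₗ[ℝ] E) hne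
    exact (LinearMap.equivOfDetNeZero (fderiv ℝ F x : E →ₗ[ℝ] E) hne).surjective
  obtain ⟨w, hw⟩ := hsurj (F x)
  have h4 := DFunLike.congr_fun h3 w
  simp [hw] at h4
  have := h.self_of_nhds
  rw [h4] at this
  simp at this

lemma det_formula (τ : ℝ) (hτ : 0 < τ) (l : E →L[ℝ] ℝ) (x : E) :
    (τ • ContinuousLinearMap.id ℝ E + l.smulRight x).det
      = τ ^ (Module.finrank ℝ E) * (1 + τ⁻¹ * l x) := by
  have h : ((τ • ContinuousLinearMap.id ℝ E + l.smulRight x : E →L[ℝ] E) : E →ₗ[ℝ] E)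
      = τ • LinearMap.transvection (τ⁻¹ • (l : E →ₗ[ℝ] ℝ)) x := by
    ext v
    simp [LinearMap.transvection.apply, smul_smul]
    rw [mul_inv_cancel_left₀ hτ.ne']
  rw [ContinuousLinearMap.det, h, LinearMap.det_smul, LinearMap.transvection.det]
  simp

lemma det_nonneg_M (x : E) (hx : x ≠ 0) (hq : ‖x‖^2 < 3) :
    0 ≤ (fderiv ℝ (clps (id : E → E)) x).det := by
  have hnx : 0 < ‖x‖ := norm_pos_iff.2 hx
  let τ : E → ℝ := fun y => (1 - bta y) + 2 * bta y * ‖y‖⁻¹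
  have hτd : DifferentiableAt ℝ τ x := by
    have hb := ((bta_contDiff (E := E)).differentiable (by simp)) x
    have hn : DifferentiableAt ℝ (fun y : E => ‖y‖) x := differentiableAt_id.norm ℝ hx
    exact ((differentiableAt_const _).sub hb).add (((differentiableAt_const _).mul hb).mul
      (hn.inv hnx.ne'))
  have hM : HasFDerivAt (clps (id : E → E))
      (τ x • ContinuousLinearMap.id ℝ E + (fderiv ℝ τ x).smulRight x) x :=
    hτd.hasFDerivAt.smul (hasFDerivAt_id x)
  set S := Real.smoothTransition with hS
  have hb0 : 0 ≤ S (‖x‖^2 - 1) := Real.smoothTransition.nonneg _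
  have hb1 : S (‖x‖^2 - 1) ≤ 1 := Real.smoothTransition.le_one _
  have hτx : τ x = (1 - S (‖x‖^2-1)) + 2 * S (‖x‖^2-1) * ‖x‖⁻¹ := by
    simp only [τ]; rw [bta_in (by linarith)]
  have hin : 0 < ‖x‖⁻¹ := by positivity
  have hx2 : ‖x‖ < 2 := by nlinarith
  have hin2 : 1 ≤ 2 * ‖x‖⁻¹ := by
    rw [← div_eq_mul_inv, le_div_iff₀ hnx]; linarith
  have hτpos : 0 < τ x := by
    rw [hτx]; nlinarith
  rw [hM.fderiv, det_formula _ hτpos]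
  refine mul_nonneg (by positivity) ?_
  -- directional derivative
  have hg1 : HasDerivAt (fun t : ℝ => τ (t • x)) (fderiv ℝ τ x x) 1 := by
    have hl : HasDerivAt (fun t : ℝ => t • x) ((1:ℝ) • x) 1 := (hasDerivAt_id (1:ℝ)).smul_const x
    rw [one_smul] at hl
    have h := hτd.hasFDerivAt
    have h' : HasFDerivAt τ (fderiv ℝ τ x) ((1:ℝ) • x) := by rwa [one_smul]
    exact h'.comp_hasDerivAt 1 hl
  have hSd : HasDerivAt S (deriv S (‖x‖^2 - 1)) ((1:ℝ)^2 * ‖x‖^2 - 1) := by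
    rw [one_pow, one_mul]
    exact ((Real.smoothTransition.contDiff (n := 1)).differentiable (by simp) _).hasDerivAt
  have hS' : 0 ≤ deriv S (‖x‖^2 - 1) := Real.smoothTransition.monotone.deriv_nonneg
  set S' := deriv S (‖x‖^2 - 1)
  have hq1 : HasDerivAt (fun t : ℝ => t^2 * ‖x‖^2 - 1) (2 * ‖x‖^2) 1 := by
    have := ((hasDerivAt_pow 2 (1:ℝ)).mul_const (‖x‖^2)).sub_const 1
    simpa using this
  have hSt : HasDerivAt (fun t : ℝ => S (t^2 * ‖x‖^2 - 1)) (S' * (2 * ‖x‖^2)) 1 :=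
    HasDerivAt.comp (h₂ := S) (h := fun t : ℝ => t^2 * ‖x‖^2 - 1) 1 hSd hq1
  have hinv : HasDerivAt (fun t : ℝ => t⁻¹ * ‖x‖⁻¹) (-‖x‖⁻¹) 1 := by
    have := (hasDerivAt_inv (one_ne_zero (α := ℝ))).mul_const (‖x‖⁻¹)
    simpa using this
  have hg2 : HasDerivAt (fun t : ℝ => (1 - S (t^2 * ‖x‖^2 - 1)) +
      (2 * S (t^2 * ‖x‖^2 - 1)) * (t⁻¹ * ‖x‖⁻¹)) _ 1 :=
    (hSt.const_sub 1).add ((hSt.const_mul 2).mul hinv)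
  have hev : (fun t : ℝ => τ (t • x)) =ᶠ[𝓝 1] (fun t : ℝ => (1 - S (t^2 * ‖x‖^2 - 1)) +
      (2 * S (t^2 * ‖x‖^2 - 1)) * (t⁻¹ * ‖x‖⁻¹)) := by
    have c1 : ∀ᶠ t : ℝ in 𝓝 1, 0 < t := eventually_gt_nhds one_pos
    have c2 : ∀ᶠ t : ℝ in 𝓝 1, t^2 * ‖x‖^2 < 8 := by
      refine ContinuousAt.eventually_lt (by fun_prop) continuousAt_const ?_
      linarith
    filter_upwards [c1, c2] with t ht ht2
    have hn : ‖t • x‖ = t * ‖x‖ := by rw [norm_smul, Real.norm_of_nonneg ht.le]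
    simp only [τ]
    rw [bta_in (by rw [hn, mul_pow]; exact ht2.le), hn, mul_pow, mul_inv]
  have heq := hg1.unique (hg2.congr_of_eventuallyEq hev)
  rw [heq]
  have key : 0 ≤ τ x * (1 + (τ x)⁻¹ * (-(S' * (2 * ‖x‖ ^ 2)) +
      (2 * (S' * (2 * ‖x‖ ^ 2)) * (1⁻¹ * ‖x‖⁻¹) + 2 * S (1 ^ 2 * ‖x‖ ^ 2 - 1) * -‖x‖⁻¹))) := by
    rw [mul_add, mul_inv_cancel_left₀ hτpos.ne', hτx]
    simp only [one_pow, one_mul, inv_one]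
    have : 0 ≤ (S' * (2 * ‖x‖ ^ 2)) * (2 * ‖x‖⁻¹ - 1) :=
      mul_nonneg (by positivity) (by linarith)
    linarith
  exact nonneg_of_mul_nonneg_right key hτpos

lemma det_neg_odd (hodd : Odd (Module.finrank ℝ E)) (A : E →L[ℝ] E) : (-A).det = -A.det := by
  have : ((-A : E →L[ℝ] E) : E →ₗ[ℝ] E) = (-1 : ℝ) • (A : E →ₗ[ℝ] E) := by ext v; simp
  rw [ContinuousLinearMap.det, this, LinearMap.det_smul, hodd.neg_one_pow]
  simp [ContinuousLinearMap.det]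

theorem no_map [MeasurableSpace E] [BorelSpace E] (μ : Measure E) [μ.IsAddHaarMeasure]
    (hodd : Odd (Module.finrank ℝ E)) (K : E → E) (hK : ContDiff ℝ 1 K)
    (hin : ∀ x, ‖x‖^2 ≤ 3 → K x = x) (hout : ∀ x, 7 ≤ ‖x‖^2 → K x = -x)
    (h0 : ∀ x, x ≠ 0 → K x ≠ 0) : False := by
  have hFc := clps_contDiff K hK h0
  have hMc := clps_contDiff (id : E → E) contDiff_id (fun x h => h)
  have hF := lemA μ (fun x => - clps K x) hFc.neg 3 (fun x hx => by
    have : 9 ≤ ‖x‖^2 := by nlinarith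
    simp [clps, bta_zero_out this, hout x (by linarith)])
  have hM := lemA μ (clps (id : E → E)) hMc 3 (fun x hx => by
    have : 9 ≤ ‖x‖^2 := by nlinarith
    simp [clps, bta_zero_out this])
  let D : E → ℝ := fun x => (fderiv ℝ (clps (id : E → E)) x).det -
    (fderiv ℝ (fun x => - clps K x) x).det
  have hneg : ∀ x, (fderiv ℝ (fun x => - clps K x) x).det = - (fderiv ℝ (clps K) x).det := by
    intro x; rw [fderiv_fun_neg, det_neg_odd hodd]
  have c1 : Continuous fun x => (fderiv ℝ (clps (id : E → E)) x).det :=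
    ContinuousLinearMap.continuous_det.comp (hMc.continuous_fderiv (by simp))
  have c2 : Continuous fun x => (fderiv ℝ (fun x => - clps K x) x).det :=
    ContinuousLinearMap.continuous_det.comp (hFc.neg.continuous_fderiv (by simp))
  have hDc : Continuous D := c1.sub c2
  have hD1 : ∀ x, ‖x‖^2 < 3 → D x = 2 * (fderiv ℝ (clps (id : E → E)) x).det := by
    intro x hx
    have : clps K =ᶠ[𝓝 x] clps id := by
      filter_upwards [(isOpenLt (E := E) 3).mem_nhds hx] with y hy
      simp only [clps, hin y (le_of_lt hy), id]
    simp only [D, hneg, this.fderiv_eq]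
    ring
  have hD2 : ∀ x, 2 < ‖x‖^2 → ‖x‖^2 < 8 → D x = 0 := by
    intro x h1 h2
    have hn := ((isOpenGt (E := E) 2).inter (isOpenLt (E := E) 8)).mem_nhds ⟨h1, h2⟩
    simp only [D, hneg]
    rw [det_zero_of_norm _ x (hFc.differentiable (by simp) x),
      det_zero_of_norm _ x (hMc.differentiable (by simp) x)]
    · simp
    · filter_upwards [hn] with y hy using clps_norm _ (fun x h => h) hy.1.le hy.2.le
    · filter_upwards [hn] with y hy using clps_norm _ h0 hy.1.le hy.2.le
  have hD3 : ∀ x, 7 < ‖x‖^2 → D x = 0 := by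
    intro x hx
    have : (fun x => - clps K x) =ᶠ[𝓝 x] clps id := by
      filter_upwards [(isOpenGt (E := E) 7).mem_nhds hx] with y hy
      simp [clps, hout y (le_of_lt hy)]
    simp only [D, this.fderiv_eq, sub_self]
  have hM0 : (fderiv ℝ (clps (id : E → E)) 0).det = 1 := by
    have : clps (id : E → E) =ᶠ[𝓝 0] id := by
      filter_upwards [(isOpenLt (E := E) 1).mem_nhds (by simp)] with y hy
      simp [clps, bta_zero_in (le_of_lt hy)]
    rw [this.fderiv_eq, fderiv_id]
    simp [ContinuousLinearMap.det]
  have hDn : 0 ≤ D := by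
    intro x
    show 0 ≤ D x
    by_cases h3 : ‖x‖^2 < 3
    · rw [hD1 x h3]
      by_cases hx : x = 0
      · rw [hx, hM0]; norm_num
      · have := det_nonneg_M x hx h3; linarith
    · by_cases h8 : ‖x‖^2 < 8
      · rw [hD2 x (by linarith) h8]
      · rw [hD3 x (by linarith)]
  have hz : ∀ x, x ∉ closedBall (0:E) 3 → D x = 0 := by
    intro x hx
    have : 3 < ‖x‖ := by simpa using hx
    exact hD3 x (by nlinarith)
  have hpos := hDc.integral_pos_of_hasCompactSupport_nonneg_nonzero (μ := μ) (x := 0)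
    (HasCompactSupport.intro (isCompact_closedBall (0:E) 3) hz) hDn
    (by rw [hD1 0 (by simp), hM0]; norm_num)
  rw [← setIntegral_eq_integral_of_forall_compl_eq_zero hz] at hpos
  simp only [D] at hpos
  rw [integral_sub (c1.continuousOn.integrableOn_compact (isCompact_closedBall _ _))
    (c2.continuousOn.integrableOn_compact (isCompact_closedBall _ _)), hM, hF, sub_self] at hpos
  exact lt_irrefl _ hpos
end

noncomputable def antip (k : ℕ) : C(Sph k, Sph k) := ⟨fun x => -x, continuous_neg⟩

lemma no_homotopy {k : ℕ} (hke : Even k)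
    (H : ContinuousMap.Homotopy (ContinuousMap.id (Sph k)) (antip k)) : False := by
  let E := EuclideanSpace ℝ (Fin (k + 1))
  have hnz : ∀ x : E, x ≠ 0 → ‖x‖⁻¹ • x ∈ Metric.sphere (0 : E) 1 := by
    intro x hx
    rw [mem_sphere_zero_iff_norm, norm_smul, norm_inv, norm_norm,
      inv_mul_cancel₀ (norm_ne_zero_iff.2 hx)]
  let f : E → E := fun x => if h : x = 0 then 0 else
    ‖x‖ • (H (projIcc 0 1 zero_le_one ((‖x‖^2 - 4)/2), ⟨‖x‖⁻¹ • x, hnz x h⟩) : E)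
  have hfin : ∀ x, ‖x‖^2 < 4 → f x = x := by
    intro x hx
    by_cases h : x = 0
    · simp [f, h]
    · simp only [f, dif_neg h]
      rw [projIcc_of_le_left _ (by linarith)]
      have := H.apply_zero ⟨‖x‖⁻¹ • x, hnz x h⟩
      rw [show (⟨0, left_mem_Icc.2 zero_le_one⟩ : unitInterval) = 0 from rfl, this]
      simp [smul_smul, mul_inv_cancel₀ (norm_ne_zero_iff.2 h)]
  have hfout : ∀ x, 6 < ‖x‖^2 → f x = -x := by
    intro x hx
    have h : x ≠ 0 := by rintro rfl; norm_num at hx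
    simp only [f, dif_neg h]
    rw [projIcc_of_right_le _ (by linarith)]
    have := H.apply_one ⟨‖x‖⁻¹ • x, hnz x h⟩
    rw [show (⟨1, right_mem_Icc.2 zero_le_one⟩ : unitInterval) = 1 from rfl, this]
    simp [antip, smul_smul, mul_inv_cancel₀ (norm_ne_zero_iff.2 h)]
  have hfn : ∀ x, ‖f x‖ = ‖x‖ := by
    intro x
    by_cases h : x = 0
    · simp [f, h]
    · simp only [f, dif_neg h]
      rw [norm_smul, norm_norm, norm_eq_of_mem_sphere, mul_one]
  have hfc : Continuous f := by
    rw [continuous_iff_continuousAt]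
    intro x
    by_cases h : x = 0
    · have : f =ᶠ[𝓝 x] id := by
        filter_upwards [(isOpenLt (E := E) 4).mem_nhds (by simp [h])] with y hy using hfin y hy
      exact continuousAt_id.congr this.symm
    · have hc : ContinuousOn f {x | x ≠ 0} := by
        rw [continuousOn_iff_continuous_domRestrict]
        have : Continuous fun x : {x : E | x ≠ 0} =>
            ‖(x:E)‖ • (H (projIcc 0 1 zero_le_one ((‖(x:E)‖^2 - 4)/2),
              ⟨‖(x:E)‖⁻¹ • (x:E), hnz x x.2⟩) : E) := by
          have h1 : Continuous fun x : {x : E | x ≠ 0} => ‖(x:E)‖⁻¹ :=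
            Continuous.inv₀ (by fun_prop) (fun x => norm_ne_zero_iff.2 x.2)
          have h2 : Continuous fun x : {x : E | x ≠ 0} =>
              projIcc (0:ℝ) 1 zero_le_one ((‖(x:E)‖^2 - 4)/2) :=
            continuous_projIcc.comp (by fun_prop)
          have h3 : Continuous fun x : {x : E | x ≠ 0} =>
              (⟨‖(x:E)‖⁻¹ • (x:E), hnz x x.2⟩ : Sph k) :=
            Continuous.subtype_mk (h1.smul continuous_subtype_val) _
          have h4 := H.continuous.comp (h2.prodMk h3)
          exact (continuous_norm.comp continuous_subtype_val).smul (continuous_subtype_val.comp h4)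
        convert this using 1
        ext1 x
        have hx : (x:E) ≠ 0 := x.2
        simp only [Set.domRestrict_apply, f, dif_neg hx]
      exact hc.continuousAt (isOpen_ne.mem_nhds h)
  let U : Set E := {x | ‖x‖^2 < 4} ∪ {x | 6 < ‖x‖^2}
  let S : Set E := {x | ‖x‖^2 ≤ 3} ∪ {x | 7 ≤ ‖x‖^2}
  have hUo : IsOpen U := (isOpenLt (E := E) 4).union (isOpenGt (E := E) 6)
  have hS : IsClosed S := (isClosed_le (by fun_prop) continuous_const).union
    (isClosed_le continuous_const (by fun_prop))
  have hSU : S ⊆ U := by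
    rintro x (hx | hx)
    · left; have : ‖x‖^2 ≤ 3 := hx
      show ‖x‖^2 < 4
      linarith
    · right; have : 7 ≤ ‖x‖^2 := hx
      show 6 < ‖x‖^2
      linarith
  have hfU : ContDiffOn ℝ (1:ℕ∞) f U := by
    rintro x (hx | hx)
    · have : f =ᶠ[𝓝 x] id := by
        filter_upwards [(isOpenLt (E := E) 4).mem_nhds hx] with y hy using hfin y hy
      exact (contDiff_id.contDiffAt.congr_of_eventuallyEq this).contDiffWithinAt
    · have : f =ᶠ[𝓝 x] fun x => -x := by
        filter_upwards [(isOpenGt (E := E) 6).mem_nhds hx] with y hy using hfout y hy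
      exact (contDiff_neg.contDiffAt.congr_of_eventuallyEq this).contDiffWithinAt
  obtain ⟨K, hK, hKf, hKS, -⟩ := hfc.exists_contDiff_approx_and_eqOn 1 (ε := fun _ => 1/2)
    continuous_const (fun _ => by norm_num) hS (hUo.mem_nhdsSet.2 hSU) hfU
  have hin : ∀ x, ‖x‖^2 ≤ 3 → K x = x := fun x hx => by
    rw [hKS (Or.inl hx), hfin x (by linarith)]
  refine no_map (volume : Measure E) ?_ K hK hin ?_ ?_
  · simp only [E, finrank_euclideanSpace_fin]
    exact hke.add_one
  · intro x hx
    rw [hKS (Or.inr hx), hfout x (by linarith)]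
  · intro x hx h0
    by_cases h : ‖x‖^2 ≤ 3
    · rw [hin x h] at h0; exact hx h0
    · have := hKf x
      rw [h0, dist_zero_left, hfn] at this
      have := norm_nonneg x
      nlinarith

lemma homotopic_antip {k : ℕ} (g : C(Sph k, Sph k)) (hg : ∀ x, g x ≠ x) :
    ContinuousMap.Homotopic g (antip k) := by
  let E := EuclideanSpace ℝ (Fin (k + 1))
  let w : unitInterval × Sph k → E := fun p => (1 - (p.1:ℝ)) • (g p.2 : E) - (p.1:ℝ) • (p.2 : E)
  have hw0 : ∀ p, w p ≠ 0 := by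
    rintro ⟨t, x⟩ h
    have h1 : (1 - (t:ℝ)) • (g x : E) = (t:ℝ) • (x : E) := sub_eq_zero.1 h
    have h2 := congrArg norm h1
    rw [norm_smul, norm_smul, norm_eq_of_mem_sphere, norm_eq_of_mem_sphere, mul_one, mul_one,
      Real.norm_of_nonneg (by linarith [t.2.2]), Real.norm_of_nonneg t.2.1] at h2
    rw [h2] at h1
    have ht : (t:ℝ) ≠ 0 := by intro h; rw [h] at h2; norm_num at h2
    exact hg x (Subtype.ext (smul_right_injective E ht h1))
  have hwc : Continuous w := by
    have : Continuous fun p : unitInterval × Sph k => (g p.2 : E) :=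
      continuous_subtype_val.comp (g.continuous.comp continuous_snd)
    fun_prop
  refine ⟨⟨⟨fun p => ⟨‖w p‖⁻¹ • w p, ?_⟩, ?_⟩, ?_, ?_⟩⟩
  · rw [mem_sphere_zero_iff_norm, norm_smul, norm_inv, norm_norm,
      inv_mul_cancel₀ (norm_ne_zero_iff.2 (hw0 p))]
  · exact Continuous.subtype_mk
      ((hwc.norm.inv₀ fun p => norm_ne_zero_iff.2 (hw0 p)).smul hwc) _
  · intro x
    ext1
    simp [w]
  · intro x
    ext1
    simp [w, antip]

/-- A nontrivial finite group acting freely by homeomorphisms on `S^k` with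
`k` even (and positive) has order 2. -/
theorem stmt_12 {k : ℕ} (hk : 0 < k) (hke : Even k) (G : Type) [Group G] [Finite G]
    [Nontrivial G] [MulAction G (Sph k)]
    (hcont : ∀ g : G, Continuous fun x : Sph k => g • x)
    (hfree : ∀ (g : G) (x : Sph k), g • x = x → g = 1) :
    Nat.card G = 2 := by
  let φ : G → C(Sph k, Sph k) := fun g => ⟨fun x => g • x, hcont g⟩
  have hφ : ∀ g, g ≠ 1 → ContinuousMap.Homotopic (φ g) (antip k) := fun g hg =>
    homotopic_antip _ fun x h => hg (hfree g x h)
  have key : ∀ g h : G, g ≠ 1 → h ≠ 1 → g * h = 1 := by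
    intro g h hg hh
    by_contra hgh
    have h1 : ContinuousMap.Homotopic ((φ g).comp (φ h)) ((antip k).comp (antip k)) :=
      (hφ g hg).comp (hφ h hh)
    have e1 : (φ g).comp (φ h) = φ (g * h) := by ext1 x; exact (mul_smul g h x).symm
    have e2 : (antip k).comp (antip k) = ContinuousMap.id _ := by ext1 x; simp [antip]
    rw [e1, e2] at h1
    obtain ⟨H⟩ := h1.symm.trans (hφ _ hgh)
    exact no_homotopy hke H
  obtain ⟨g, hg⟩ := exists_ne (1 : G)
  rw [Nat.card_eq_two_iff]
  refine ⟨1, g, hg.symm, ?_⟩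
  ext h
  simp only [Set.mem_insert_iff, Set.mem_singleton_iff, Set.mem_univ, iff_true]
  by_cases hh : h = 1
  · exact Or.inl hh
  · right
    exact mul_left_cancel ((key g h hg hh).trans (key g g hg hg).symm)
end

section
/- Let G × S^k → S^k be a free continuous action of the circle group S¹ on the sphere S^k with all orbit spaces S^k/Z_l manifolds. Then k is odd. -/
/-- The cyclic subgroup `Z_l = {z | z^l = 1}` of the circle group. -/
noncomputable def Zl (l : ℕ) : Subgroup Circle where
  carrier := {z | z ^ l = 1}
  one_mem' := one_pow l
  mul_mem' := by
    intro a b ha hb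
    simp only [Set.mem_setOf_eq] at *
    rw [mul_pow, ha, hb, one_mul]
  inv_mem' := by
    intro a ha
    simp only [Set.mem_setOf_eq] at *
    rw [inv_pow, ha, inv_one]

section hb
open Polynomial

lemma hb_poly {n : ℕ} (hn : Odd n) (Q : ℝ[X]) (c : ℝ) (hc : c ≠ 0)
    (h : Q ^ 2 = C c * (1 + X ^ 2) ^ n) : False := by
  have h2 := congrArg (fun p => (p.map (algebraMap ℝ ℂ)).roots.count Complex.I) h
  have e : (1 + X ^ 2 : ℂ[X]) = (X - C Complex.I) * (X - C (-Complex.I)) := by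
    have : (C Complex.I * C Complex.I : ℂ[X]) = -1 := by
      rw [← C_mul, Complex.I_mul_I]; simp
    rw [C_neg]; linear_combination this
  have hne : (X - C Complex.I) * (X - C (-Complex.I)) ≠ 0 :=
    mul_ne_zero (X_sub_C_ne_zero _) (X_sub_C_ne_zero _)
  have hI : Complex.I ≠ -Complex.I := by
    intro h; have := congrArg Complex.im h; norm_num at this
  have hc' : (c : ℂ) ≠ 0 := by exact_mod_cast hc
  simp only [Polynomial.map_pow, Polynomial.map_mul, map_C, Polynomial.map_add, Polynomial.map_one, map_X, e,
    roots_pow] at h2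
  rw [roots_C_mul _ (by simpa using hc'), roots_pow, roots_mul hne, roots_X_sub_C, roots_X_sub_C] at h2
  simp [Multiset.count_nsmul, hI] at h2
  rcases hn with ⟨m, hm⟩
  omega

lemma hb_detpoly {n : ℕ} (A : EuclideanSpace ℝ (Fin n) →L[ℝ] EuclideanSpace ℝ (Fin n)) :
    ∃ q : ℝ[X], q.natDegree ≤ n ∧ ∀ t : ℝ, q.eval t = (1 + t • A).det := by
  let b := (EuclideanSpace.basisFun (Fin n) ℝ).toBasis
  let M := LinearMap.toMatrix b b (A : EuclideanSpace ℝ (Fin n) →ₗ[ℝ] EuclideanSpace ℝ (Fin n))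
  refine ⟨(((X : ℝ[X]) • M.map C) + (1 : Matrix (Fin n) (Fin n) ℝ).map C).det, ?_, ?_⟩
  · simpa using natDegree_det_X_add_C_le M 1
  · intro t
    rw [ContinuousLinearMap.det, ← LinearMap.det_toMatrix b]
    simp only [← coe_evalRingHom]
    rw [RingHom.map_det]
    congr 1
    have : ((1 + t • A : EuclideanSpace ℝ (Fin n) →L[ℝ] EuclideanSpace ℝ (Fin n)) : EuclideanSpace ℝ (Fin n) →ₗ[ℝ] EuclideanSpace ℝ (Fin n)) = LinearMap.id + t • (A : EuclideanSpace ℝ (Fin n) →ₗ[ℝ] EuclideanSpace ℝ (Fin n)) := rfl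
    rw [this, (LinearMap.toMatrix b b).map_add, (LinearMap.toMatrix b b).map_smul, LinearMap.toMatrix_id]
    ext i j
    by_cases hij : i = j <;> simp [M, hij] <;> ring

lemma hb_detpos {n : ℕ} (A : EuclideanSpace ℝ (Fin n) →L[ℝ] EuclideanSpace ℝ (Fin n)) (t : ℝ)
    (ht : 0 ≤ t) (h : t * ‖A‖ < 1) : 0 < (1 + t • A).det := by
  obtain ⟨q, -, hq⟩ := hb_detpoly A
  have hnz : ∀ s ∈ Set.Icc 0 t, q.eval s ≠ 0 := by
    intro s hs
    rw [hq]
    have h1 : ‖-(s • A)‖ < 1 := by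
      rw [norm_neg, norm_smul, Real.norm_of_nonneg hs.1]
      exact lt_of_le_of_lt (mul_le_mul_of_nonneg_right hs.2 (norm_nonneg _)) h
    have h2 := (isUnit_one_sub_of_norm_lt_one h1)
    rw [sub_neg_eq_add] at h2
    have := h2.map (ContinuousLinearMap.toLinearMapRingHom (R₁ := ℝ) (M₁ := EuclideanSpace ℝ (Fin n)))
    exact (this.map LinearMap.det).ne_zero
  have h0 : q.eval 0 = 1 := by
    rw [hq, _root_.zero_smul ℝ A, add_zero]; exact LinearMap.det_id
  rw [← hq]
  by_contra hcon
  push Not at hcon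
  have := intermediate_value_Icc' ht (q.continuous.continuousOn (s := Set.Icc 0 t))
  obtain ⟨s, hs, hs0⟩ := this ⟨hcon, by rw [h0]; norm_num⟩
  exact hnz s hs hs0

open MeasureTheory in
lemma hb_core {n : ℕ} (hn1 : 1 ≤ n) (v : EuclideanSpace ℝ (Fin n) → EuclideanSpace ℝ (Fin n))
    (K : NNReal) (hK : LipschitzWith K v) (hd : ∀ x, x ≠ 0 → DifferentiableAt ℝ v x)
    (ho : ∀ x, inner ℝ x (v x) = 0) (hnorm : ∀ x, ‖v x‖ = ‖x‖) : ¬ Odd n := by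
  intro hn
  have hnt : Nontrivial (EuclideanSpace ℝ (Fin n)) := by
    have : Nonempty (Fin n) := ⟨⟨0, hn1⟩⟩
    infer_instance
  set s : Set (EuclideanSpace ℝ (Fin n)) := Metric.ball 0 1 \ {0} with hs
  have hsm : MeasurableSet s := Metric.isOpen_ball.measurableSet.diff (measurableSet_singleton _)
  set δ : ℝ := 1 / (K + 1) with hδ
  have hδ0 : 0 < δ := by positivity
  have hδK : ∀ t, 0 ≤ t → t < δ → t * K < 1 := by
    intro t ht0 ht
    have h1 : t * (K + 1) < 1 := by
      rwa [hδ, lt_div_iff₀ (by positivity)] at ht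
    linarith
  set c : ℝ := volume.real (Metric.ball (0 : EuclideanSpace ℝ (Fin n)) 1) with hc
  have hc0 : 0 < c := by
    rw [hc]
    exact ENNReal.toReal_pos (Metric.measure_ball_pos _ _ one_pos).ne' measure_ball_lt_top.ne
  have hnf : ∀ t : ℝ, ∀ x, ‖x + t • v x‖ = Real.sqrt (1 + t ^ 2) * ‖x‖ := by
    intro t x
    rw [← sq_eq_sq₀ (norm_nonneg _) (by positivity), mul_pow, Real.sq_sqrt (by positivity),
      norm_add_sq_real, inner_smul_right, ho, norm_smul, hnorm, mul_pow, Real.norm_eq_abs, sq_abs]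
    ring
  have key : ∀ t, 0 ≤ t → t < δ →
      IntegrableOn (fun x => (1 + t • fderiv ℝ v x).det) s ∧
      ∫ x in s, (1 + t • fderiv ℝ v x).det = Real.sqrt (1 + t ^ 2) ^ n * c := by
    intro t ht0 ht
    have htK := hδK t ht0 ht
    have hr : 0 < Real.sqrt (1 + t ^ 2) := Real.sqrt_pos.2 (by positivity)
    let f : EuclideanSpace ℝ (Fin n) → EuclideanSpace ℝ (Fin n) := fun x => x + t • v x
    have hapx : ApproximatesLinearOn f ((ContinuousLinearEquiv.refl ℝ (EuclideanSpace ℝ (Fin n)) :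
        EuclideanSpace ℝ (Fin n) ≃L[ℝ] EuclideanSpace ℝ (Fin n)) :
        EuclideanSpace ℝ (Fin n) →L[ℝ] EuclideanSpace ℝ (Fin n)) Set.univ (t.toNNReal * K) := by
      intro x _ y _
      have : f x - f y - (x - y) = t • (v x - v y) := by simp only [f, smul_sub]; abel
      simp only [ContinuousLinearEquiv.coe_refl, ContinuousLinearMap.coe_id', id]
      rw [this, norm_smul, Real.norm_of_nonneg ht0]
      push_cast
      rw [Real.coe_toNNReal _ ht0, mul_assoc]
      gcongr
      have := hK.dist_le_mul x y
      rwa [dist_eq_norm, dist_eq_norm] at this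
    have hcc : t.toNNReal * K < ‖((ContinuousLinearEquiv.refl ℝ (EuclideanSpace ℝ (Fin n))).symm :
        EuclideanSpace ℝ (Fin n) →L[ℝ] EuclideanSpace ℝ (Fin n))‖₊⁻¹ := by
      rw [ContinuousLinearEquiv.refl_symm, ContinuousLinearEquiv.coe_refl, ← NNReal.coe_lt_coe]
      push_cast
      rw [Real.coe_toNNReal _ ht0, ContinuousLinearMap.norm_id]
      simpa using htK
    have hsurj : Function.Surjective f := hapx.surjective (Or.inr hcc)
    have hinj : Set.InjOn f s := (hapx.injOn (Or.inr hcc)).mono (Set.subset_univ _)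
    have himg : f '' s = Metric.ball 0 (Real.sqrt (1 + t ^ 2)) \ {0} := by
      ext y
      constructor
      · rintro ⟨x, ⟨hx1, hx0⟩, rfl⟩
        have hx0' : 0 < ‖x‖ := norm_pos_iff.2 hx0
        have hx1' : ‖x‖ < 1 := by simpa using hx1
        refine ⟨?_, ?_⟩
        · simp only [mem_ball_zero_iff, f, hnf]
          nlinarith
        · have : 0 < ‖f x‖ := by simp only [f, hnf]; positivity
          exact norm_pos_iff.1 this
      · rintro ⟨hy1, hy0⟩
        obtain ⟨x, rfl⟩ := hsurj y
        have hy0' : 0 < ‖f x‖ := norm_pos_iff.2 hy0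
        simp only [mem_ball_zero_iff, f, hnf] at hy1 hy0'
        refine ⟨x, ⟨?_, ?_⟩, rfl⟩
        · rw [mem_ball_zero_iff]
          by_contra hcon
          push Not at hcon
          nlinarith
        · exact norm_pos_iff.1 (pos_of_mul_pos_right hy0' hr.le)
    have hder : ∀ x ∈ s, HasFDerivWithinAt f (1 + t • fderiv ℝ v x) s x := by
      intro x hx
      exact ((hasFDerivAt_id x).add (((hd x hx.2).hasFDerivAt).const_smul t)).hasFDerivWithinAt
    have hpos : ∀ x, 0 < (1 + t • fderiv ℝ v x).det := by
      intro x
      apply hb_detpos _ _ ht0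
      refine lt_of_le_of_lt ?_ htK
      exact mul_le_mul_of_nonneg_left (norm_fderiv_le_of_lipschitz ℝ hK) ht0
    have hI := integrableOn_image_iff_integrableOn_abs_det_fderiv_smul volume hsm hder hinj
      (fun _ => (1 : ℝ))
    have hE := integral_image_eq_integral_abs_det_fderiv_smul volume hsm hder hinj
      (fun _ => (1 : ℝ))
    simp only [abs_of_pos (hpos _), smul_eq_mul, mul_one] at hI hE
    have hvol : volume.real (f '' s) = Real.sqrt (1 + t ^ 2) ^ n * c := by
      rw [himg, Measure.real, measure_sdiff_null (measure_singleton _),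
        Measure.addHaar_ball _ _ hr.le, ENNReal.toReal_mul, ENNReal.toReal_ofReal (by positivity)]
      simp [hc, Measure.real]
    constructor
    · rw [← hI]
      refine integrableOn_const ?_
      rw [himg]
      exact (lt_of_le_of_lt (measure_mono Set.sdiff_subset) measure_ball_lt_top).ne
    · rw [← hE, ← hvol]
      simp
  choose q hqd hq using fun x => hb_detpoly (fderiv ℝ v x)
  let nd : ℕ → ℝ := fun i => δ * (i / (n + 1))
  have hnd0 : ∀ i, 0 ≤ nd i := fun i => by positivity
  have hnd1 : ∀ i ∈ Finset.range (n + 1), nd i < δ := by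
    intro i hi
    have : (i : ℝ) < n + 1 := by exact_mod_cast Finset.mem_range.1 hi
    have h2 : (i : ℝ) / (n + 1) < 1 := by rw [div_lt_one (by positivity)]; exact this
    simp only [nd]
    nlinarith
  have hinj : Set.InjOn nd (Finset.range (n + 1)) := by
    intro i _ j _ hij
    simp only [nd] at hij
    have h1 := mul_left_cancel₀ hδ0.ne' hij
    have h2 : (i : ℝ) = j := by
      field_simp at h1
      exact h1
    exact_mod_cast h2
  have hlag : ∀ x t, (q x).eval t = ∑ i ∈ Finset.range (n + 1),
      (q x).eval (nd i) * (Lagrange.basis (Finset.range (n + 1)) nd i).eval t := by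
    intro x t
    have h1 : (q x).degree < (Finset.range (n + 1)).card := by
      rw [Finset.card_range]
      refine lt_of_le_of_lt degree_le_natDegree ?_
      have := hqd x
      exact_mod_cast Nat.lt_succ_of_le this
    conv_lhs => rw [Lagrange.eq_interpolate hinj h1, Lagrange.interpolate_apply]
    simp [eval_finsetSum]
  let Q : ℝ[X] := ∑ i ∈ Finset.range (n + 1),
    C (Real.sqrt (1 + nd i ^ 2) ^ n * c) * Lagrange.basis (Finset.range (n + 1)) nd i
  have hQ : ∀ t, 0 ≤ t → t < δ → Q.eval t = Real.sqrt (1 + t ^ 2) ^ n * c := by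
    intro t ht0 ht
    rw [← (key t ht0 ht).2]
    simp only [← hq, hlag _ t]
    rw [integral_finsetSum]
    · simp only [Q, eval_finsetSum, eval_mul, eval_C]
      refine Finset.sum_congr rfl fun i hi => ?_
      rw [integral_mul_const]
      simp only [hq]
      rw [(key _ (hnd0 i) (hnd1 i hi)).2]
    · intro i hi
      simp only [hq]
      exact (key _ (hnd0 i) (hnd1 i hi)).1.mul_const _
  refine hb_poly hn Q (c ^ 2) (by positivity) ?_
  apply Polynomial.eq_of_infinite_eval_eq
  refine Set.Infinite.mono ?_ (Set.Ico_infinite hδ0)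
  intro t ht
  simp only [Set.mem_ofPred_eq, eval_pow, hQ t ht.1 ht.2, eval_mul, eval_C, eval_add, eval_one, eval_X]
  rw [mul_pow, ← pow_mul, mul_comm n 2, pow_mul, Real.sq_sqrt (by positivity)]
  ring

end hb

lemma hb_homog {n : ℕ} (hn1 : 1 ≤ n) (u : EuclideanSpace ℝ (Fin n) → EuclideanSpace ℝ (Fin n))
    (hu : ∀ x, ‖x‖ = 1 → ContDiffAt ℝ 1 u x) (hu1 : ∀ x, ‖x‖ = 1 → ‖u x‖ = 1)
    (huo : ∀ x, ‖x‖ = 1 → inner ℝ x (u x) = 0) : ¬ Odd n := by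
  have hll : LocallyLipschitzOn (Metric.sphere (0 : EuclideanSpace ℝ (Fin n)) 1) u := by
    intro x hx
    obtain ⟨K, t, ht, h⟩ := (hu x (by simpa using hx)).exists_lipschitzOnWith
    exact ⟨K, t, mem_nhdsWithin_of_mem_nhds ht, h⟩
  obtain ⟨K, hK⟩ := hll.exists_lipschitzOnWith_of_compact (isCompact_sphere _ _)
  have hnu : ∀ x : EuclideanSpace ℝ (Fin n), x ≠ 0 → ‖‖x‖⁻¹ • x‖ = 1 := by
    intro x hx
    rw [norm_smul, norm_inv, norm_norm, inv_mul_cancel₀ (norm_ne_zero_iff.2 hx)]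
  have hxx : ∀ x : EuclideanSpace ℝ (Fin n), x ≠ 0 → ‖x‖ • ‖x‖⁻¹ • x = x := by
    intro x hx
    rw [smul_smul, mul_inv_cancel₀ (norm_ne_zero_iff.2 hx), one_smul]
  have hvn : ∀ x, ‖(‖x‖ • u (‖x‖⁻¹ • x))‖ = ‖x‖ := by
    intro x
    by_cases hx : x = 0
    · simp [hx]
    · rw [norm_smul, norm_norm, hu1 _ (hnu x hx), mul_one]
  refine hb_core hn1 (fun x => ‖x‖ • u (‖x‖⁻¹ • x)) (1 + 2 * K) ?_ ?_ ?_ hvn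
  · apply LipschitzWith.of_dist_le_mul
    intro x y
    rw [dist_eq_norm, dist_eq_norm]
    push_cast
    have hK0 : (0 : ℝ) ≤ K := K.2
    by_cases hx : x = 0
    · subst hx
      simp only [norm_zero, zero_smul, zero_sub, norm_neg, hvn]
      nlinarith [norm_nonneg y]
    by_cases hy : y = 0
    · subst hy
      simp only [norm_zero, zero_smul, sub_zero, hvn]
      nlinarith [norm_nonneg x]
    set a := ‖x‖⁻¹ • x with ha
    set b := ‖y‖⁻¹ • y with hb
    have hab : ‖u a - u b‖ ≤ K * ‖a - b‖ := by
      have := hK.dist_le_mul a (by simpa using hnu x hx) b (by simpa using hnu y hy)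
      rwa [dist_eq_norm, dist_eq_norm] at this
    have hnn : |‖x‖ - ‖y‖| ≤ ‖x - y‖ := abs_norm_sub_norm_le x y
    have h1 : ‖y‖ * ‖a - b‖ ≤ 2 * ‖x - y‖ := by
      have e : ‖y‖ • (a - b) = (‖y‖ - ‖x‖) • a + (x - y) := by
        rw [smul_sub, sub_smul, hxx x hx, hxx y hy]; abel
      calc ‖y‖ * ‖a - b‖ = ‖‖y‖ • (a - b)‖ := by rw [norm_smul, norm_norm]
        _ ≤ ‖(‖y‖ - ‖x‖) • a‖ + ‖x - y‖ := by rw [e]; exact norm_add_le _ _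
        _ ≤ 2 * ‖x - y‖ := by
          rw [norm_smul, hnu x hx, mul_one, Real.norm_eq_abs, abs_sub_comm]; linarith
    have e : ‖x‖ • u a - ‖y‖ • u b = (‖x‖ - ‖y‖) • u a + ‖y‖ • (u a - u b) := by
      rw [smul_sub, sub_smul]; abel
    calc ‖‖x‖ • u a - ‖y‖ • u b‖ ≤ ‖(‖x‖ - ‖y‖) • u a‖ + ‖‖y‖ • (u a - u b)‖ := by
          rw [e]; exact norm_add_le _ _
      _ = |‖x‖ - ‖y‖| + ‖y‖ * ‖u a - u b‖ := by
          rw [norm_smul, norm_smul, norm_norm, hu1 a (hnu x hx), mul_one, Real.norm_eq_abs]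
      _ ≤ ‖x - y‖ + ‖y‖ * (K * ‖a - b‖) := by gcongr
      _ = ‖x - y‖ + K * (‖y‖ * ‖a - b‖) := by ring
      _ ≤ ‖x - y‖ + K * (2 * ‖x - y‖) := by gcongr
      _ = (1 + 2 * K) * ‖x - y‖ := by ring
  · intro x hx
    have h1 : DifferentiableAt ℝ (fun x : EuclideanSpace ℝ (Fin n) => ‖x‖) x :=
      (contDiffAt_norm ℝ hx).differentiableAt one_ne_zero
    have h2 : DifferentiableAt ℝ (fun x : EuclideanSpace ℝ (Fin n) => ‖x‖⁻¹ • x) x :=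
      (h1.inv (norm_ne_zero_iff.2 hx)).smul differentiableAt_id
    have h3 : DifferentiableAt ℝ u (‖x‖⁻¹ • x) :=
      (hu _ (hnu x hx)).differentiableAt one_ne_zero
    exact h1.smul (DifferentiableAt.comp (g := u) (f := fun x => ‖x‖⁻¹ • x) x h3 h2)
  · intro x
    by_cases hx : x = 0
    · simp [hx]
    · have := huo _ (hnu x hx)
      rw [inner_smul_left] at this
      have h2 : (starRingEnd ℝ) ‖x‖⁻¹ ≠ 0 := by simpa using hx
      rw [inner_smul_right, (mul_eq_zero.1 this).resolve_left h2, mul_zero]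

lemma hb_cont {n : ℕ} (hn1 : 1 ≤ n) (F : EuclideanSpace ℝ (Fin n) → EuclideanSpace ℝ (Fin n))
    (hF : Continuous F) (h : ∀ x, ‖x‖ = 1 → F x - (inner ℝ x (F x) : ℝ) • x ≠ 0) : ¬ Odd n := by
  have hne : (Metric.sphere (0 : EuclideanSpace ℝ (Fin n)) 1).Nonempty := by
    have : Nonempty (Fin n) := ⟨⟨0, hn1⟩⟩
    exact NormedSpace.sphere_nonempty.2 zero_le_one
  obtain ⟨x0, hx0, hmin⟩ := (isCompact_sphere (0 : EuclideanSpace ℝ (Fin n)) 1).exists_isMinOn hne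
    (f := fun x => ‖F x - (inner ℝ x (F x) : ℝ) • x‖) (by fun_prop)
  set d := ‖F x0 - (inner ℝ x0 (F x0) : ℝ) • x0‖ with hd
  have hd0 : 0 < d := norm_pos_iff.2 (h x0 (by simpa using hx0))
  obtain ⟨w, hw, hwd, -⟩ := hF.exists_contDiff_approx 1 (ε := fun _ => d / 2) continuous_const
    (fun _ => half_pos hd0)
  let p : EuclideanSpace ℝ (Fin n) → EuclideanSpace ℝ (Fin n) :=
    fun x => w x - (inner ℝ x (w x) : ℝ) • x
  have hp : ContDiff ℝ 1 p := hw.sub ((contDiff_id.inner ℝ hw).smul contDiff_id)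
  have hp0 : ∀ x, ‖x‖ = 1 → p x ≠ 0 := by
    intro x hx hpx
    have h1 : d ≤ ‖F x - (inner ℝ x (F x) : ℝ) • x‖ := hmin (by simpa using hx)
    have h2 : F x - (inner ℝ x (F x) : ℝ) • x
        = (F x - w x) - (inner ℝ x (F x - w x) : ℝ) • x := by
      have h3 : w x - (inner ℝ x (w x) : ℝ) • x = 0 := hpx
      rw [inner_sub_right, sub_smul, ← sub_eq_zero]
      rw [← h3]; abel
    have h4 : ‖F x - w x‖ < d / 2 := by
      have := hwd x
      rwa [dist_comm, dist_eq_norm] at this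
    have h5 : ‖(inner ℝ x (F x - w x) : ℝ) • x‖ ≤ ‖F x - w x‖ := by
      rw [norm_smul, hx, mul_one]
      simpa [hx] using norm_inner_le_norm (𝕜 := ℝ) x (F x - w x)
    rw [h2] at h1
    have := norm_sub_le (F x - w x) ((inner ℝ x (F x - w x) : ℝ) • x)
    linarith
  refine hb_homog hn1 (fun x => ‖p x‖⁻¹ • p x) ?_ ?_ ?_
  · intro x hx
    exact ((hp.contDiffAt.norm ℝ (hp0 x hx)).inv (norm_ne_zero_iff.2 (hp0 x hx))).smul
      hp.contDiffAt
  · intro x hx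
    rw [norm_smul, norm_inv, norm_norm, inv_mul_cancel₀ (norm_ne_zero_iff.2 (hp0 x hx))]
  · intro x hx
    simp only [p]
    rw [inner_smul_right, inner_sub_right, inner_smul_right, real_inner_self_eq_norm_sq, hx]
    ring


/-- Let `S¹ × S^k → S^k` be a free continuous action of the circle group on
`S^k` such that for every `l ≥ 1` the orbit space `S^k/Z_l` of the induced (free) action of the
cyclic subgroup `Z_l ⊆ S¹` is a topological manifold. Then `k` is odd. -/
theorem stmt_14 {k : ℕ} (hk : 1 ≤ k) [MulAction Circle (Sph k)]
    [ContinuousSMul Circle (Sph k)]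
    (hfree : ∀ (g : Circle) (x : Sph k), g • x = x → g = 1)
    (htame : ∀ l : ℕ, 1 ≤ l → ∃ m : ℕ, Nonempty
      (ChartedSpace (EuclideanSpace ℝ (Fin m))
        (Quotient (MulAction.orbitRel (Zl l) (Sph k))))) :
    Odd k := by
  have hev : ∀ᶠ t : ℝ in nhds 0, ∀ x ∈ (Set.univ : Set (Sph k)),
      ((Circle.exp t • x : Sph k) : EuclideanSpace ℝ (Fin (k + 1))) ≠ -x := by
    refine isCompact_univ.eventually_forall_of_forall_eventually
      (P := fun (t : ℝ) (x : Sph k) =>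
        ((Circle.exp t • x : Sph k) : EuclideanSpace ℝ (Fin (k + 1))) ≠ -x) ?_
    intro x _
    have hc1 : Continuous (fun z : ℝ × Sph k =>
        ((Circle.exp z.1 • z.2 : Sph k) : EuclideanSpace ℝ (Fin (k + 1)))) :=
      continuous_subtype_val.comp ((Circle.exp.continuous.comp continuous_fst).smul continuous_snd)
    have hc2 : Continuous (fun z : ℝ × Sph k => -(z.2 : EuclideanSpace ℝ (Fin (k + 1)))) :=
      (continuous_subtype_val.comp continuous_snd).neg
    refine (isOpen_ne_fun hc1 hc2).mem_nhds ?_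
    show ((Circle.exp 0 • x : Sph k) : EuclideanSpace ℝ (Fin (k + 1))) ≠ -x
    rw [Circle.exp_zero, one_smul]
    intro hx
    have h1 : (x : EuclideanSpace ℝ (Fin (k + 1))) = 0 := by
      have h3 : (2 : ℝ) • (x : EuclideanSpace ℝ (Fin (k + 1))) = 0 := by
        rw [two_smul]; nth_rewrite 1 [hx]; exact neg_add_cancel _
      exact (smul_eq_zero.1 h3).resolve_left two_ne_zero
    have h2 : ‖(x : EuclideanSpace ℝ (Fin (k + 1)))‖ = 1 := by simp
    rw [h1] at h2
    simp at h2
  obtain ⟨ε, hε, hball⟩ := Metric.eventually_nhds_iff.1 hev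
  obtain ⟨t, ht0, ht⟩ := exists_between (lt_min hε Real.pi_pos)
  have htε : t < ε := lt_of_lt_of_le ht (min_le_left _ _)
  have htπ : t < Real.pi := lt_of_lt_of_le ht (min_le_right _ _)
  have hneg := hball (y := t) (by rw [Real.dist_eq, sub_zero, abs_of_pos ht0]; exact htε)
  have hg : Circle.exp t ≠ 1 := by
    intro h
    obtain ⟨m, hm⟩ := Circle.exp_eq_one.1 h
    have hm0 : 0 < (m : ℝ) := by
      by_contra hcon
      push Not at hcon
      nlinarith [Real.pi_pos]
    have hm1 : (1 : ℝ) ≤ m := by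
      have : 0 < m := by exact_mod_cast hm0
      exact_mod_cast this
    nlinarith [Real.pi_pos]
  obtain ⟨F, hF⟩ := ContinuousMap.exists_restrict_eq
    (Metric.isClosed_sphere (x := (0 : EuclideanSpace ℝ (Fin (k + 1)))) (ε := 1))
    (⟨fun x : Sph k => ((Circle.exp t • x : Sph k) : EuclideanSpace ℝ (Fin (k + 1))),
      continuous_subtype_val.comp (continuous_const_smul _)⟩ : C(Sph k, _))
  have hFx : ∀ x : Sph k, F x = ((Circle.exp t • x : Sph k) : EuclideanSpace ℝ (Fin (k + 1))) :=
    fun x => DFunLike.congr_fun hF x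
  have hno := hb_cont (Nat.le_add_left 1 k) F F.continuous (by
    intro x hx h0
    let y : Sph k := ⟨x, by simpa using hx⟩
    have hy : F x = ((Circle.exp t • y : Sph k) : EuclideanSpace ℝ (Fin (k + 1))) := hFx y
    have hn : ‖F x‖ = 1 := by
      rw [hy]; simp
    have h1 : F x = (inner ℝ x (F x) : ℝ) • x := sub_eq_zero.1 h0
    have h2 : |(inner ℝ x (F x) : ℝ)| = 1 := by
      have := congrArg norm h1
      rw [norm_smul, hx, mul_one, hn, Real.norm_eq_abs] at this
      exact this.symm
    rcases (abs_eq zero_le_one).1 h2 with h3 | h3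
    · rw [h3, one_smul, hy] at h1
      exact hg (hfree _ y (Subtype.ext h1))
    · rw [h3, neg_smul, one_smul, hy] at h1
      exact hneg y (Set.mem_univ _) h1)
  rcases Nat.even_or_odd k with he | ho
  · exact absurd he.add_one hno
  · exact ho
end

section
/- Let k ≥ 3 be odd, let G be a finite group acting freely and tamely on S^k, and let j ≥ 2. Then the image of the homomorphism π_j(F_n(S^k/G)) → ∏₁ⁿ π_j(S^k/G) induced by the inclusion i_n : F_n(S^k/G) ↪ (S^k/G)^n equals the diagonal subgroup Δ = {(α,…,α) : α ∈ π_j(S^k/G)}. -/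
open scoped unitInterval Topology

noncomputable section

/-- The orbit space `S^k/G`. -/
abbrev OrbQ (k : ℕ) (G : Type) [Group G] [MulAction G (Sph k)] : Type :=
  Quotient (MulAction.orbitRel G (Sph k))

/-- Constant on the boundary. -/
def BC {j : ℕ} {X : Type} [TopologicalSpace X] (f : C(Fin j → I, X)) : Prop :=
  ∀ t ∈ Cube.boundary (Fin j), ∀ t' ∈ Cube.boundary (Fin j), f t = f t'

abbrev FH {j : ℕ} {X : Type} [TopologicalSpace X] (f g : C(Fin j → I, X)) : Prop :=
  f.HomotopicWith g BC

def rhoF (j : ℕ) : C(Fin j → I, Fin j → I) :=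
  ⟨fun t i => Set.projIcc (0 : ℝ) 1 zero_le_one (2 * (t i : ℝ) - 1 / 2),
    continuous_pi fun i => continuous_projIcc.comp (by fun_prop)⟩

def ccF {j : ℕ} (t : Fin j → I) : ℝ := ‖(fun i => 4 * (t i : ℝ) - 2)‖ - 1

theorem ccF_cont {j : ℕ} : Continuous (ccF (j := j)) := by
  unfold ccF; fun_prop

theorem ccF_bdry {j : ℕ} {t : Fin j → I} (ht : t ∈ Cube.boundary (Fin j)) : 1 ≤ ccF t := by
  obtain ⟨i, hi⟩ := ht
  have h := norm_le_pi_norm (fun i => 4 * (t i : ℝ) - 2) i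
  have : ‖4 * (t i : ℝ) - 2‖ = 2 := by
    rcases hi with hi | hi <;> rw [hi] <;> norm_num
  simp only [this] at h
  unfold ccF; linarith

theorem rho_bdry {j : ℕ} {t : Fin j → I} (ht : 0 ≤ ccF t) : rhoF j t ∈ Cube.boundary (Fin j) := by
  by_contra hc
  have : ‖(fun i => 4 * (t i : ℝ) - 2)‖ < 1 := by
    rw [pi_norm_lt_iff one_pos]
    intro i
    rw [Real.norm_eq_abs, abs_lt]
    constructor
    · by_contra h
      refine hc ⟨i, Or.inl ?_⟩
      exact Set.projIcc_of_le_left zero_le_one (by linarith)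
    · by_contra h
      refine hc ⟨i, Or.inr ?_⟩
      exact Set.projIcc_of_right_le zero_le_one (by linarith)
  unfold ccF at ht; linarith

theorem collar {j : ℕ} {A X : Type} [TopologicalSpace A] [TopologicalSpace X]
    (F : C(A × (Fin j → I), X)) (D : C(A × I, X))
    (h : ∀ a, ∀ t ∈ Cube.boundary (Fin j), F (a, t) = D (a, 0)) :
    ∃ K : C(A × (Fin j → I), X), (∀ a, ∀ t ∈ Cube.boundary (Fin j), K (a, t) = D (a, 1)) ∧
      (∀ a, (∀ u, D (a, u) = D (a, 0)) → ∀ t, K (a, t) = F (a, rhoF j t)) := by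
  classical
  let K : A × (Fin j → I) → X := fun p => if ccF p.2 ≤ 0 then F (p.1, rhoF j p.2)
    else D (p.1, Set.projIcc (0 : ℝ) 1 zero_le_one (ccF p.2))
  have hK : Continuous K := by
    refine Continuous.if_le ?_ ?_ (ccF_cont.comp continuous_snd) continuous_const ?_
    · fun_prop
    · exact D.continuous.comp (continuous_fst.prodMk
        (continuous_projIcc.comp (ccF_cont.comp continuous_snd)))
    · intro p hp
      rw [h _ _ (rho_bdry hp.ge), Set.projIcc_of_le_left _ hp.le]; rfl
  refine ⟨⟨K, hK⟩, fun a t ht => ?_, fun a ha t => ?_⟩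
  · have h1 := ccF_bdry ht
    simp only [ContinuousMap.coe_mk, K]
    rw [if_neg (by linarith), Set.projIcc_of_right_le _ h1]; rfl
  · simp only [ContinuousMap.coe_mk, K]
    split_ifs with hc
    · rfl
    · rw [ha, h _ _ (rho_bdry (by linarith))]

/-- straight line in the cube -/
def lineC (j : ℕ) : C(I × (Fin j → I), Fin j → I) :=
  ⟨fun p i => ⟨(1 - (p.1 : ℝ)) * (p.2 i : ℝ) + p.1 * (rhoF j p.2 i : ℝ), by
    have h1 := p.1.2; have h2 := (p.2 i).2; have h3 := (rhoF j p.2 i).2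
    constructor
    · have := mul_nonneg (sub_nonneg.2 h1.2) h2.1
      have := mul_nonneg h1.1 h3.1
      linarith
    · nlinarith [mul_le_mul_of_nonneg_left h2.2 (sub_nonneg.2 h1.2),
        mul_le_mul_of_nonneg_left h3.2 h1.1]⟩, by fun_prop⟩

theorem rho_zero {j : ℕ} {t : Fin j → I} {i : Fin j} (h : t i = 0) : rhoF j t i = 0 := by
  refine Set.projIcc_of_le_left zero_le_one ?_
  rw [h]; norm_num

theorem rho_one {j : ℕ} {t : Fin j → I} {i : Fin j} (h : t i = 1) : rhoF j t i = 1 := by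
  refine Set.projIcc_of_right_le zero_le_one ?_
  rw [h]; norm_num

theorem lineC_bdry {j : ℕ} (s : I) {t : Fin j → I} (ht : t ∈ Cube.boundary (Fin j)) :
    lineC j (s, t) ∈ Cube.boundary (Fin j) := by
  obtain ⟨i, hi | hi⟩ := ht
  · refine ⟨i, Or.inl (Subtype.ext ?_)⟩
    simp [lineC, rho_zero hi, hi]
  · refine ⟨i, Or.inr (Subtype.ext ?_)⟩
    simp [lineC, rho_one hi, hi]

theorem rho_homotopicRel {j : ℕ} {X : Type} [TopologicalSpace X] (f : C(Fin j → I, X))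
    (hf : BC f) : f.HomotopicRel (f.comp (rhoF j)) (Cube.boundary (Fin j)) := by
  refine ⟨⟨⟨f.comp (lineC j), fun t => ?_, fun t => ?_⟩, fun s t ht => ?_⟩⟩
  · simp only [ContinuousMap.toFun_eq_coe, ContinuousMap.comp_apply]
    congr 1; ext i; simp [lineC]
  · simp only [ContinuousMap.toFun_eq_coe, ContinuousMap.comp_apply]
    congr 1; ext i; simp [lineC]
  · exact hf _ (lineC_bdry s ht) _ ht

theorem FH_of_rel {j : ℕ} {X : Type} [TopologicalSpace X] {f g : C(Fin j → I, X)}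
    (hf : BC f) (h : f.HomotopicRel g (Cube.boundary (Fin j))) : FH f g := by
  obtain ⟨H⟩ := h
  refine ⟨⟨H.toHomotopy, fun s t ht t' ht' => ?_⟩⟩
  have h1 := H.eq_fst s ht
  have h2 := H.eq_fst s ht'
  change H (s, t) = H (s, t')
  rw [h1, h2, hf t ht t' ht']

/-- Change of base point. -/
theorem base_change {j : ℕ} {X : Type} [TopologicalSpace X] {x y : X}
    (α : GenLoop (Fin j) X x) (δ : Path x y) : ∃ α' : GenLoop (Fin j) X y, FH α'.1 α.1 := by
  obtain ⟨K, hK1, hK2⟩ := collar (j := j) (A := I) (X := X)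
    ⟨fun p => α.1 p.2, by fun_prop⟩ ⟨fun p => δ (p.1 * p.2), by fun_prop⟩
    (fun a t ht => by simpa using α.2 t ht)
  have hbc : BC α.1 := fun t ht t' ht' => by rw [α.2 t ht, α.2 t' ht']
  refine ⟨⟨⟨fun t => K (1, t), by fun_prop⟩, fun t ht => ?_⟩, ?_⟩
  · have := hK1 1 t ht
    simpa using this
  · refine ContinuousMap.HomotopicWith.symm (ContinuousMap.HomotopicWith.trans
      (FH_of_rel hbc (rho_homotopicRel _ hbc)) ⟨⟨⟨K, fun t => ?_, fun t => rfl⟩, ?_⟩⟩)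
    · have := hK2 0 (by simp) t
      simpa using this
    · intro s t ht t' ht'
      change K (s, t) = K (s, t')
      rw [hK1 s t ht, hK1 s t' ht']

theorem rel_of_FH {j : ℕ} {X : Type} [TopologicalSpace X] {x : X} (hj : 0 < j)
    (hX : ∀ p : Path x x, p.Homotopic (Path.refl x))
    (α β : GenLoop (Fin j) X x) (h : FH α.1 β.1) : GenLoop.Homotopic α β := by
  obtain ⟨H⟩ := h
  let o : Fin j → I := fun _ => 0
  have ho : o ∈ Cube.boundary (Fin j) := ⟨⟨0, hj⟩, Or.inl rfl⟩
  let p : Path x x := ⟨⟨fun s => H (s, o), by fun_prop⟩, by simpa using α.2 o ho,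
    by simpa using β.2 o ho⟩
  obtain ⟨D⟩ := hX p
  have hp : ∀ s, ∀ t ∈ Cube.boundary (Fin j), H (s, t) = H (s, o) := fun s t ht =>
    H.prop' s t ht o ho
  obtain ⟨K, hK1, hK2⟩ := collar (j := j) (A := I) (X := X) H.toContinuousMap
    ⟨fun q => D (q.2, q.1), by fun_prop⟩ (fun a t ht => by
      have := hp a t ht
      simpa [p] using this)
  have hba : BC α.1 := fun t ht t' ht' => by rw [α.2 t ht, α.2 t' ht']
  have hbb : BC β.1 := fun t ht t' ht' => by rw [β.2 t ht, β.2 t' ht']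
  refine (rho_homotopicRel _ hba).trans
    (ContinuousMap.HomotopicRel.trans ?_ (rho_homotopicRel _ hbb).symm)
  refine ⟨⟨⟨K, fun t => ?_, fun t => ?_⟩, fun s t ht => ?_⟩⟩
  · have := hK2 0 (by simp) t
    simpa using this
  · have := hK2 1 (by simp) t
    simpa using this
  · have := hK1 s t ht
    have h2 := α.2 _ (rho_bdry (le_trans zero_le_one (ccF_bdry ht)))
    change K (s, t) = α.1 (rhoF j t)
    rw [h2, this]; simp

theorem FH_comp {j : ℕ} {X Y : Type} [TopologicalSpace X] [TopologicalSpace Y]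
    {φ ψ : C(X, Y)} (h : φ.Homotopic ψ) {α β : C(Fin j → I, X)} (hα : FH α β) :
    FH (φ.comp α) (ψ.comp β) := by
  obtain ⟨H⟩ := h
  obtain ⟨K⟩ := hα
  refine ⟨⟨⟨⟨fun p => H (p.1, K p), by fun_prop⟩, fun t => by simp, fun t => by simp⟩, ?_⟩⟩
  intro s t ht t' ht'
  have := K.prop' s t ht t' ht'
  change K (s, t) = K (s, t') at this
  change H (s, K (s, t)) = H (s, K (s, t'))
  rw [this]

theorem BC_gen {j : ℕ} {X : Type} [TopologicalSpace X] {x : X} (α : GenLoop (Fin j) X x) :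
    BC α.1 := fun t ht t' ht' => by rw [α.2 t ht, α.2 t' ht']

theorem sph_norm {k : ℕ} (x : Sph k) : ‖(x : EuclideanSpace ℝ (Fin (k + 1)))‖ = 1 := by
  simpa using x.2

def nrm {k : ℕ} {A : Type} [TopologicalSpace A] (F : A → EuclideanSpace ℝ (Fin (k + 1)))
    (hF : Continuous F) (h0 : ∀ a, F a ≠ 0) : C(A, Sph k) :=
  ⟨fun a => ⟨‖F a‖⁻¹ • F a, by
    simp [norm_smul, norm_ne_zero_iff.2 (h0 a)]⟩,
   Continuous.subtype_mk ((hF.norm.inv₀ fun a => norm_ne_zero_iff.2 (h0 a)).smul hF) _⟩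

theorem nrm_val {k : ℕ} {A : Type} [TopologicalSpace A] (F : A → EuclideanSpace ℝ (Fin (k + 1)))
    (hF : Continuous F) (h0 : ∀ a, F a ≠ 0) (a : A) :
    (nrm F hF h0 a : EuclideanSpace ℝ (Fin (k + 1))) = ‖F a‖⁻¹ • F a := rfl

theorem nrm_eq {k : ℕ} {A : Type} [TopologicalSpace A] {F : A → EuclideanSpace ℝ (Fin (k + 1))}
    {hF : Continuous F} {h0 : ∀ a, F a ≠ 0} {a : A} {x : Sph k} (h : F a = x) :
    nrm F hF h0 a = x := by
  apply Subtype.ext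
  rw [nrm_val, h, sph_norm]; simp

theorem sph_homotopy {k : ℕ} {A : Type} [TopologicalSpace A] (f g : C(A, Sph k))
    (h : ∀ a, (f a : EuclideanSpace ℝ (Fin (k + 1))) ≠ -(g a : EuclideanSpace ℝ (Fin (k + 1)))) :
    ∃ H : f.Homotopy g, (∀ s a a', f a = f a' → g a = g a' → H (s, a) = H (s, a')) ∧
      ∀ s a, f a = g a → H (s, a) = f a := by
  have h0 : ∀ p : I × A, (1 - (p.1 : ℝ)) • (f p.2 : EuclideanSpace ℝ (Fin (k + 1))) +
      (p.1 : ℝ) • (g p.2 : EuclideanSpace ℝ (Fin (k + 1))) ≠ 0 := by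
    rintro ⟨s, a⟩ hc
    simp only at hc
    have h1 := eq_neg_of_add_eq_zero_left hc
    have h2 := congrArg norm h1
    rw [norm_neg, norm_smul, norm_smul, sph_norm, sph_norm, Real.norm_of_nonneg s.2.1,
      Real.norm_of_nonneg (sub_nonneg.2 s.2.2)] at h2
    have h3 : (s : ℝ) = 1 / 2 := by linarith
    rw [h3, ← smul_neg] at h1
    norm_num at h1
    have h5 := congrArg (fun z => (2 : ℝ) • z) h1
    simp only [smul_neg, smul_smul] at h5
    norm_num at h5
    exact h a h5
  refine ⟨⟨nrm (fun p : I × A => (1 - (p.1 : ℝ)) • (f p.2 : EuclideanSpace ℝ (Fin (k + 1))) +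
      (p.1 : ℝ) • (g p.2 : EuclideanSpace ℝ (Fin (k + 1)))) (by fun_prop) h0, fun a => ?_,
      fun a => ?_⟩, fun s a a' h1 h2 => ?_, fun s a h1 => ?_⟩
  · exact nrm_eq (by simp)
  · exact nrm_eq (by simp)
  · apply Subtype.ext
    change ‖_‖⁻¹ • _ = ‖_‖⁻¹ • _
    simp only [h1, h2]
  · refine nrm_eq (hF := by fun_prop) (h0 := h0) ?_
    simp only [← h1]
    rw [← add_smul]; simp

theorem exists_J {k : ℕ} (hk : Odd k) : ∃ J : EuclideanSpace ℝ (Fin (k + 1)) → EuclideanSpace ℝ (Fin (k + 1)),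
    Continuous J ∧ (∀ x, ‖J x‖ = ‖x‖) ∧ ∀ x, inner ℝ x (J x) = 0 := by
  obtain ⟨m, rfl⟩ := hk
  let sg : Fin (2 * m + 1 + 1) → Fin (2 * m + 1 + 1) := fun i =>
    if h : i.1 % 2 = 0 then ⟨i.1 + 1, by omega⟩ else ⟨i.1 - 1, by omega⟩
  have hsg : Function.Involutive sg := by
    intro i
    apply Fin.ext
    by_cases h : i.1 % 2 = 0
    · have h2 : ¬ (i.1 + 1) % 2 = 0 := by omega
      simp [sg, h, h2]
    · have h2 : (i.1 - 1) % 2 = 0 := by omega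
      simp [sg, h, h2]; omega
  let e : Fin (2 * m + 1 + 1) → ℝ := fun i => if i.1 % 2 = 0 then 1 else -1
  have he : ∀ i, e (sg i) = - e i := by
    intro i
    by_cases h : i.1 % 2 = 0
    · have h2 : ¬ (i.1 + 1) % 2 = 0 := by omega
      simp [sg, e, h, h2]
    · have h2 : (i.1 - 1) % 2 = 0 := by omega
      simp [sg, e, h, h2]
  have he2 : ∀ i, ‖e i‖ = 1 := by
    intro i; simp only [e]; split_ifs <;> simp
  refine ⟨fun x => WithLp.toLp 2 (fun i => e i * x (sg i)), by fun_prop, fun x => ?_, fun x => ?_⟩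
  · rw [EuclideanSpace.norm_eq, EuclideanSpace.norm_eq]
    congr 1
    simp only [norm_mul, he2, one_mul]
    exact Equiv.sum_comp hsg.toPerm (fun i => ‖x i‖ ^ 2)
  · have key : (inner ℝ x (WithLp.toLp 2 (fun i => e i * x (sg i))) : ℝ)
        = ∑ i, e i * (x i * x (sg i)) := by
      rw [PiLp.inner_apply]
      refine Finset.sum_congr rfl fun i _ => ?_
      simp [mul_comm, mul_left_comm]
    rw [key]
    have h2 := Equiv.sum_comp hsg.toPerm (fun i => e i * (x i * x (sg i)))
    simp only [Function.Involutive.coe_toPerm, he, hsg _] at h2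
    have h3 : ∑ i, -e i * (x (sg i) * x i) = - ∑ i, e i * (x i * x (sg i)) := by
      rw [← Finset.sum_neg_distrib]
      refine Finset.sum_congr rfl fun i _ => by ring
    linarith

theorem exists_rot {k : ℕ} (hk : Odd k) : ∃ R : C(ℝ × Sph k, Sph k),
    (∀ x, R (0, x) = x) ∧
    (∀ x, (R (Real.pi, x) : EuclideanSpace ℝ (Fin (k + 1))) = -(x : EuclideanSpace ℝ (Fin (k + 1)))) ∧
    (∀ θ φ x, dist (R (θ, x)) (R (φ, x)) ≤ 2 * |θ - φ|) ∧
    (∀ (θ : ℝ) (x : Sph k), inner ℝ (x : EuclideanSpace ℝ (Fin (k + 1))) (R (θ, x) : EuclideanSpace ℝ (Fin (k + 1)))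
      = Real.cos θ) := by
  obtain ⟨J, hJ, hJn, hJi⟩ := exists_J hk
  have hmem : ∀ p : ℝ × Sph k, Real.cos p.1 • (p.2 : EuclideanSpace ℝ (Fin (k + 1))) +
      Real.sin p.1 • J p.2 ∈ Metric.sphere (0 : EuclideanSpace ℝ (Fin (k + 1))) 1 := by
    rintro ⟨θ, x⟩
    rw [mem_sphere_zero_iff_norm]
    have h := norm_add_sq_real (Real.cos θ • (x : EuclideanSpace ℝ (Fin (k + 1))))
      (Real.sin θ • J x)
    rw [real_inner_smul_left, real_inner_smul_right, hJi, norm_smul, norm_smul, hJn, sph_norm] at h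
    have h1 : ‖Real.cos θ • (x : EuclideanSpace ℝ (Fin (k + 1))) + Real.sin θ • J x‖ ^ 2 = 1 := by
      rw [h]; simp
    have h2 := norm_nonneg (Real.cos θ • (x : EuclideanSpace ℝ (Fin (k + 1))) + Real.sin θ • J x)
    simpa using (pow_eq_one_iff_of_nonneg h2 two_ne_zero).1 h1
  refine ⟨⟨fun p => ⟨_, hmem p⟩, ?_⟩, fun x => ?_, fun x => ?_, fun θ φ x => ?_, fun θ x => ?_⟩
  · refine Continuous.subtype_mk ?_ _
    have := hJ.comp (continuous_subtype_val.comp (continuous_snd (X := ℝ) (Y := Sph k)))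
    simp only [Function.comp_def] at this
    fun_prop
  · apply Subtype.ext; simp
  · simp
  · rw [Subtype.dist_eq, dist_eq_norm]
    simp only [ContinuousMap.coe_mk]
    have : Real.cos θ • (x : EuclideanSpace ℝ (Fin (k + 1))) + Real.sin θ • J x
      - (Real.cos φ • (x : EuclideanSpace ℝ (Fin (k + 1))) + Real.sin φ • J x)
      = (Real.cos θ - Real.cos φ) • (x : EuclideanSpace ℝ (Fin (k + 1))) +
        (Real.sin θ - Real.sin φ) • J x := by
      module
    rw [this]
    refine (norm_add_le _ _).trans ?_
    rw [norm_smul, norm_smul, hJn, sph_norm, Real.norm_eq_abs, Real.norm_eq_abs]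
    have := Real.abs_cos_sub_cos_le θ φ
    have := Real.abs_sin_sub_sin_le θ φ
    linarith
  · simp only [ContinuousMap.coe_mk]
    rw [inner_add_right, real_inner_smul_right, real_inner_smul_right, hJi,
      real_inner_self_eq_norm_sq, sph_norm]
    simp

theorem sph_loop_null {k : ℕ} (hk : 3 ≤ k) (x : Sph k) (p : Path x x) :
    p.Homotopic (Path.refl x) := by
  -- smooth approximation
  have hpc : Continuous fun t : ℝ => (p.extend t : EuclideanSpace ℝ (Fin (k + 1))) := by
    fun_prop
  obtain ⟨g, hg, hgd, -⟩ := hpc.exists_contDiff_approx (ε := fun _ => 1 / 4) 1 (by fun_prop)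
    (fun _ => by norm_num)
  let P : ℝ → EuclideanSpace ℝ (Fin (k + 1)) := fun t =>
    g t + (1 - t) • ((x : EuclideanSpace ℝ (Fin (k + 1))) - g 0) +
      t • ((x : EuclideanSpace ℝ (Fin (k + 1))) - g 1)
  have hP : ContDiff ℝ 1 P := by
    have hg' : ContDiff ℝ 1 g := hg
    fun_prop
  have hP0 : P 0 = x := by simp [P]
  have hP1 : P 1 = x := by simp [P]
  have hPd : ∀ t : I, ‖P t - (p t : EuclideanSpace ℝ (Fin (k + 1)))‖ < 1 := by
    intro t
    have h1 := hgd t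
    have h2 := hgd 0
    have h3 := hgd 1
    rw [dist_eq_norm] at h1 h2 h3
    simp only [Path.extend_zero, Path.extend_one, Path.extend_apply] at h1 h2 h3
    rw [norm_sub_rev] at h2 h3
    have : P t - (p t : EuclideanSpace ℝ (Fin (k + 1))) = (g t - p t) + 
      (1 - (t : ℝ)) • ((x : EuclideanSpace ℝ (Fin (k + 1))) - g 0) +
      (t : ℝ) • ((x : EuclideanSpace ℝ (Fin (k + 1))) - g 1) := by simp only [P]; abel
    rw [this]
    refine (norm_add_le _ _).trans_lt ?_
    have := norm_add_le (g t - p t) ((1 - (t : ℝ)) • ((x : EuclideanSpace ℝ (Fin (k + 1))) - g 0))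
    rw [norm_smul, Real.norm_of_nonneg (sub_nonneg.2 t.2.2)] at this
    rw [norm_smul, Real.norm_of_nonneg t.2.1]
    have e1 := t.2.1
    have e2 := t.2.2
    have e3 : p.extend (t : ℝ) = p t := by simp
    rw [e3] at h1
    nlinarith [norm_nonneg ((x : EuclideanSpace ℝ (Fin (k + 1))) - g 0),
      norm_nonneg ((x : EuclideanSpace ℝ (Fin (k + 1))) - g 1)]
  have hPne : ∀ t : I, P t ≠ 0 := by
    intro t h
    have := hPd t
    rw [h, zero_sub, norm_neg, sph_norm] at this
    exact lt_irrefl _ this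
  let q : C(I, Sph k) := nrm (fun t : I => P t) (hP.continuous.comp continuous_subtype_val) hPne
  have hq0 : q 0 = x := nrm_eq (by simpa using hP0)
  have hq1 : q 1 = x := nrm_eq (by simpa using hP1)
  let Q : Path x x := ⟨q, hq0, hq1⟩
  have hpq : p.Homotopic Q := by
    obtain ⟨H, -, hH⟩ := sph_homotopy p.toContinuousMap q (by
      intro t h
      have h1 := hPd t
      have h2 : P t = ‖P t‖ • (q t : EuclideanSpace ℝ (Fin (k + 1))) := by
        simp only [q, nrm_val]
        rw [smul_smul, mul_inv_cancel₀ (norm_ne_zero_iff.2 (hPne t)), one_smul]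
      have h4 : (p t : EuclideanSpace ℝ (Fin (k + 1))) = - (q t : EuclideanSpace ℝ (Fin (k + 1))) := h
      have h3 : P t - (p t : EuclideanSpace ℝ (Fin (k + 1))) =
          (‖P t‖ + 1) • (q t : EuclideanSpace ℝ (Fin (k + 1))) := by
        rw [h4, add_smul, one_smul, sub_neg_eq_add, ← h2]
      rw [h3, norm_smul, sph_norm, Real.norm_of_nonneg (by positivity)] at h1
      have := norm_nonneg (P t)
      linarith)
    refine ⟨⟨H, fun s t ht => ?_⟩⟩
    refine hH s t ?_
    rcases ht with rfl | rfl
    · change p 0 = q 0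
      rw [hq0]; exact p.source
    · change p 1 = q 1
      rw [hq1]; exact p.target
  -- a point missed
  have hdense : Dense (Set.range fun z : ℝ × ℝ => z.1 • P z.2)ᶜ := by
    apply ContDiff.dense_compl_range_of_finrank_lt_finrank
    · fun_prop
    · simp; omega
  obtain ⟨w, hw⟩ := hdense.nonempty
  have hw0 : w ≠ 0 := by
    rintro rfl
    exact hw ⟨(0, 0), by simp⟩
  let v : EuclideanSpace ℝ (Fin (k + 1)) := ‖w‖⁻¹ • w
  have hv : ‖v‖ = 1 := by
    simp [v, norm_smul, norm_ne_zero_iff.2 hw0]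
  have hvq : ∀ t, (q t : EuclideanSpace ℝ (Fin (k + 1))) ≠ v := by
    intro t h
    simp only [q, nrm_val, v] at h
    apply hw
    refine ⟨(‖w‖ * ‖P t‖⁻¹, t), ?_⟩
    simp only
    rw [mul_smul, h, smul_smul, mul_inv_cancel₀ (norm_ne_zero_iff.2 hw0), one_smul]
  refine hpq.trans ?_
  let st := stereographic hv
  have hst : ∀ t, q t ∈ st.source := by
    intro t
    rw [stereographic_source]
    intro h
    exact hvq t (congrArg Subtype.val h)
  have hqs : Continuous fun t => st (q t) :=
    st.continuousOn.comp_continuous q.continuous hst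
  have hsym : Continuous st.symm := by
    have := st.continuousOn_symm
    rw [stereographic_target] at this
    exact continuousOn_univ.1 this
  refine ⟨⟨⟨⟨fun z => st.symm ((1 - (z.1 : ℝ)) • st (q z.2) + (z.1 : ℝ) • st x), ?_⟩,
    fun t => ?_, fun t => ?_⟩, fun s t ht => ?_⟩⟩
  · have h1 : Continuous fun z : I × I => st (q z.2) := hqs.comp continuous_snd
    have h2 : Continuous fun z : I × I => ((1 - (z.1 : ℝ)) • st (q z.2)) :=
      Continuous.smul (f := fun z : I × I => 1 - (z.1 : ℝ)) (by fun_prop) h1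
    have h3 : Continuous fun z : I × I => ((z.1 : ℝ) • st x) :=
      Continuous.smul (f := fun z : I × I => (z.1 : ℝ)) (by fun_prop) continuous_const
    exact hsym.comp (h2.add h3)
  · simp [st.left_inv (hst t), Q]
  · have := st.left_inv (hst 0)
    rw [hq0] at this
    simp [this]
  · have := st.left_inv (hst 0)
    rw [hq0] at this
    have e : q t = x := by
      rcases ht with rfl | rfl
      · exact hq0
      · exact hq1
    change st.symm ((1 - (s : ℝ)) • st (q t) + (s : ℝ) • st x) = q t
    rw [e, ← add_smul]; simp [this]
theorem sph_infinite {k : ℕ} (hk : 3 ≤ k) : Infinite (Sph k) := by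
  have h1 : 1 < Module.rank ℝ (EuclideanSpace ℝ (Fin (k + 1))) := by
    rw [← Module.finrank_eq_rank]; simp; omega
  have h := isConnected_sphere h1 0 zero_le_one
  obtain ⟨x, hx⟩ := h.nonempty
  refine Set.infinite_coe_iff.2 (h.isPreconnected.infinite_of_nontrivial ⟨x, hx, -x, by simpa using hx, ?_⟩)
  intro hc
  have h2 : (2 : ℝ) • x = 0 := by
    rw [two_smul]; nth_rewrite 1 [hc]; simp
  have : x = 0 := by simpa using h2
  rw [this] at hx; simp at hx

theorem sph_joined {k : ℕ} (hk : 3 ≤ k) (s : Set (Sph k)) (hs : s.Finite) (a b : Sph k)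
    (ha : a ∉ s) (hb : b ∉ s) : JoinedIn sᶜ a b := by
  have := sph_infinite hk
  obtain ⟨v, hv⟩ := (hs.insert a |>.insert b).exists_notMem
  simp only [Set.mem_insert_iff, not_or] at hv
  have : Fact (Module.finrank ℝ (EuclideanSpace ℝ (Fin (k + 1))) = k + 1) := ⟨by simp⟩
  let st := stereographic' k v
  have hsym : Continuous st.symm := by
    have := st.continuousOn_symm
    rw [stereographic'_target] at this
    exact continuousOn_univ.1 this
  have hinj : Function.Injective st.symm := by
    intro y z h
    exact st.symm.injOn (by simp [st]) (by simp [st]) h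
  have hc : (st.symm ⁻¹' s).Countable := (hs.preimage hinj.injOn).countable
  have hpc := hc.isPathConnected_compl_of_one_lt_rank (by
    rw [← Module.finrank_eq_rank]; simp; omega)
  have key : ∀ c, v ≠ c → st.symm (st c) = c := by
    intro c hc
    apply st.left_inv
    rw [stereographic'_source]
    exact fun h => hc h.symm
  have hj := hpc.joinedIn (st a) (by simpa [key a hv.2.1] using ha) (st b)
    (by simpa [key b hv.1] using hb)
  obtain ⟨γ, hγ⟩ := hj
  refine ⟨(γ.map hsym).cast (key a hv.2.1).symm (key b hv.1).symm, fun t => ?_⟩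
  exact hγ t

theorem conf_joinedIn {X Y : Type} [TopologicalSpace X] [Infinite Y] (p : X → Y)
    (hp : Function.Surjective p) (hfin : ∀ y, (p ⁻¹' {y}).Finite)
    (hX : ∀ s : Set X, s.Finite → ∀ a b, a ∉ s → b ∉ s → JoinedIn sᶜ a b)
    {n : ℕ} (x y : Fin n → X) (hx : Function.Injective (p ∘ x)) (hy : Function.Injective (p ∘ y)) :
    JoinedIn {z : Fin n → X | Function.Injective (p ∘ z)} x y := by
  classical
  have step : ∀ x w : Fin n → X, Function.Injective (p ∘ x) → Function.Injective (p ∘ w) →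
      (∀ i l, p (x i) ≠ p (w l)) →
      JoinedIn {z : Fin n → X | Function.Injective (p ∘ z)} x w := by
    intro x w hx hw hxw
    let z : Finset (Fin n) → Fin n → X := fun S i => if i ∈ S then w i else x i
    have hz : ∀ S, Function.Injective (p ∘ z S) := by
      intro S i l h
      simp only [Function.comp, z] at h
      split_ifs at h
      · exact hw h
      · exact absurd h.symm (hxw _ _)
      · exact absurd h (hxw _ _)
      · exact hx h
    have key : ∀ S, JoinedIn {z : Fin n → X | Function.Injective (p ∘ z)} x (z S) := by
      intro S
      induction S using Finset.induction_on with
      | empty =>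
        have : z ∅ = x := by ext i; simp [z]
        rw [this]; exact JoinedIn.refl hx
      | insert a S ha ih =>
        refine ih.trans ?_
        let s : Set X := ⋃ l ∈ {l : Fin n | l ≠ a}, p ⁻¹' {p (z S l)}
        have hs : s.Finite := Set.Finite.biUnion (Set.toFinite _) fun l _ => hfin _
        have hmem : ∀ c, c ∉ s → ∀ l, l ≠ a → p c ≠ p (z S l) := by
          intro c hc l hl h
          exact hc (Set.mem_biUnion hl h)
        have hza : z S a = x a := by simp [z, ha]
        obtain ⟨γ, hγ⟩ := hX s hs (x a) (w a) (by
            intro h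
            simp only [s, Set.mem_iUnion] at h
            obtain ⟨l, hl, h⟩ := h
            rw [← hza] at h
            exact hl (hz S h).symm) (by
            intro h
            simp only [s, Set.mem_iUnion] at h
            obtain ⟨l, hl, h⟩ := h
            simp only [Set.mem_preimage, Set.mem_singleton_iff, z] at h
            split_ifs at h
            · exact hl (hw h).symm
            · exact hxw _ _ h.symm)
        have e1 : Function.update (z S) a (x a) = z S := by
          rw [← hza]; exact Function.update_eq_self _ _
        have e2 : Function.update (z S) a (w a) = z (insert a S) := by
          ext i
          by_cases h : i = a
          · subst h; simp [z]
          · simp [z, h]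
        refine ⟨(γ.map (f := fun c => Function.update (z S) a c)
          (continuous_const.update a continuous_id)).cast e1.symm e2.symm, fun t => ?_⟩
        have hm := hmem _ (hγ t)
        intro i l h
        change p (Function.update (z S) a (γ t) i) = p (Function.update (z S) a (γ t) l) at h
        by_cases hi : i = a <;> by_cases hl : l = a
        · rw [hi, hl]
        · subst hi
          rw [Function.update_self, Function.update_of_ne hl] at h
          exact absurd h (hm l hl)
        · subst hl
          rw [Function.update_self, Function.update_of_ne hi] at h
          exact absurd h.symm (hm i hi)
        · rw [Function.update_of_ne hi, Function.update_of_ne hl] at h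
          exact hz S h
    have : z Finset.univ = w := by ext i; simp [z]
    rw [← this]; exact key _
  -- intermediate configuration
  have hfinxy : (Set.range (p ∘ x) ∪ Set.range (p ∘ y)).Finite :=
    (Set.finite_range _).union (Set.finite_range _)
  have hinf := hfinxy.infinite_compl
  let em := hinf.natEmbedding
  choose r hr using hp
  let w : Fin n → X := fun i => r (em i)
  have hpw : ∀ i, p (w i) = em i := fun i => hr _
  have hw : Function.Injective (p ∘ w) := by
    intro i l h
    simp only [Function.comp, hpw] at h
    exact Fin.ext (em.injective (Subtype.ext h))
  have h1 : ∀ i l, p (x i) ≠ p (w l) := by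
    intro i l h
    rw [hpw] at h
    exact (em l).2 (Or.inl ⟨i, h⟩)
  have h2 : ∀ i l, p (y i) ≠ p (w l) := by
    intro i l h
    rw [hpw] at h
    exact (em l).2 (Or.inr ⟨i, h⟩)
  exact (step x w hx hw h1).trans (step y w hy hw h2).symm

theorem push_local {k : ℕ} {Y : Type} [TopologicalSpace Y] [T2Space Y]
    (e : OpenPartialHomeomorph Y (EuclideanSpace ℝ (Fin k))) (c v : EuclideanSpace ℝ (Fin k)) (r : ℝ)
    (hr : 0 < r) (hc : Metric.closedBall c r ⊆ e.target) (hv : ‖v‖ ≤ r) :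
    ∃ T : C(Y, Y), T (e.symm c) = e.symm (c + v) ∧ T.Homotopic (ContinuousMap.id Y) := by
  classical
  let B := Metric.closedBall c r
  let K : Set Y := e.symm '' B
  have hKc : IsClosed K :=
    ((isCompact_closedBall c r).image_of_continuousOn (e.continuousOn_symm.mono hc)).isClosed
  let U : Set Y := e.source ∩ e ⁻¹' Metric.ball c r
  have hU : IsOpen U := e.continuousOn.isOpen_inter_preimage e.open_source Metric.isOpen_ball
  have hKs : ∀ y ∈ K, y ∈ e.source ∧ e y ∈ B := by
    rintro _ ⟨z, hz, rfl⟩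
    exact ⟨e.map_target (hc hz), by rw [e.right_inv (hc hz)]; exact hz⟩
  have hUK : U ⊆ K := by
    rintro y ⟨hy1, hy2⟩
    exact ⟨e y, Metric.ball_subset_closedBall hy2, e.left_inv hy1⟩
  let m : I × EuclideanSpace ℝ (Fin k) → EuclideanSpace ℝ (Fin k) := fun q =>
    q.2 + ((1 - (q.1 : ℝ)) * (1 - ‖q.2 - c‖ / r)) • v
  have hm : Continuous m := by fun_prop
  have hmB : ∀ s, ∀ z ∈ B, m (s, z) ∈ B := by
    intro s z hz
    have hz' : ‖z - c‖ ≤ r := by simpa [B, dist_eq_norm] using hz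
    have h1 : ‖z - c‖ / r ≤ 1 := (div_le_one hr).2 hz'
    have h2 := s.2.1
    have h3 := s.2.2
    simp only [B, Metric.mem_closedBall, dist_eq_norm, m]
    have : z + ((1 - (s : ℝ)) * (1 - ‖z - c‖ / r)) • v - c =
      (z - c) + ((1 - (s : ℝ)) * (1 - ‖z - c‖ / r)) • v := by abel
    rw [this]
    refine (norm_add_le _ _).trans ?_
    have h4 : 0 ≤ (1 - (s : ℝ)) * (1 - ‖z - c‖ / r) :=
      mul_nonneg (by linarith) (by linarith)
    rw [norm_smul, Real.norm_of_nonneg h4]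
    have h5 : (1 - (s : ℝ)) * (1 - ‖z - c‖ / r) ≤ 1 - ‖z - c‖ / r := by
      nlinarith
    have h6 : (1 - (s : ℝ)) * (1 - ‖z - c‖ / r) * ‖v‖ ≤ (1 - ‖z - c‖ / r) * r :=
      mul_le_mul h5 hv (norm_nonneg _) (by linarith)
    have h7 : (1 - ‖z - c‖ / r) * r = r - ‖z - c‖ := by field_simp
    linarith
  let H : I × Y → Y := fun q => if q.2 ∈ K then e.symm (m (q.1, e q.2)) else q.2
  have hHU : ∀ q : I × Y, q.2 ∉ U → H q = q.2 := by
    rintro ⟨s, y⟩ hy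
    by_cases hK : y ∈ K
    · obtain ⟨h1, h2⟩ := hKs y hK
      have h3 : ‖e y - c‖ = r := by
        have h4 : ‖e y - c‖ ≤ r := by simpa [B, dist_eq_norm] using h2
        refine le_antisymm h4 (not_lt.1 fun h => hy ⟨h1, ?_⟩)
        simpa [dist_eq_norm] using h
      simp only [H, hK, if_true, m, h3, div_self hr.ne']
      simp [e.left_inv h1]
    · simp [H, hK]
  have hH1 : ContinuousOn H (Prod.snd ⁻¹' K) := by
    have : ContinuousOn (fun q : I × Y => e.symm (m (q.1, e q.2))) (Prod.snd ⁻¹' K) := by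
      refine e.continuousOn_symm.comp (hm.comp_continuousOn
        (continuousOn_fst.prodMk (e.continuousOn.comp continuousOn_snd fun q hq => (hKs _ hq).1))) ?_
      intro q hq
      exact hc (hmB _ _ (hKs _ hq).2)
    refine this.congr fun q hq => ?_
    have hq' : q.2 ∈ K := hq
    simp [H, hq']
  have hH2 : ContinuousOn H (Prod.snd ⁻¹' Uᶜ) := by
    refine continuousOn_snd.congr fun q hq => hHU q hq
  have hH : Continuous H := by
    rw [← continuousOn_univ]
    have : (Set.univ : Set (I × Y)) = Prod.snd ⁻¹' K ∪ Prod.snd ⁻¹' Uᶜ := by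
      ext q
      simp only [Set.mem_univ, Set.mem_union, Set.mem_preimage, Set.mem_compl_iff, true_iff]
      by_cases h : q.2 ∈ U
      · exact Or.inl (hUK h)
      · exact Or.inr h
    rw [this]
    exact hH1.union_of_isClosed hH2 (hKc.preimage continuous_snd)
      (hU.isClosed_compl.preimage continuous_snd)
  have hcB : c ∈ B := Metric.mem_closedBall_self hr.le
  refine ⟨⟨fun y => H (0, y), hH.comp (by fun_prop)⟩, ?_, ⟨⟨⟨H, hH⟩, fun y => rfl, fun y => ?_⟩⟩⟩
  · have hK : e.symm c ∈ K := ⟨c, hcB, rfl⟩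
    simp only [ContinuousMap.coe_mk, H, hK, if_true, m, e.right_inv (hc hcB)]
    simp
  · change H (1, y) = y
    by_cases hK : y ∈ K
    · simp [H, hK, m, e.left_inv (hKs y hK).1]
    · simp [H, hK]

theorem exists_push {k : ℕ} {Y : Type} [TopologicalSpace Y] [T2Space Y] [PreconnectedSpace Y]
    [ChartedSpace (EuclideanSpace ℝ (Fin k)) Y] (a b : Y) :
    ∃ T : C(Y, Y), T a = b ∧ T.Homotopic (ContinuousMap.id Y) := by
  let S : Set Y := {b | ∃ T : C(Y, Y), T a = b ∧ T.Homotopic (ContinuousMap.id Y)}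
  have haS : a ∈ S := ⟨ContinuousMap.id Y, rfl, ContinuousMap.Homotopic.refl _⟩
  have htr : ∀ c ∈ S, ∀ d, (∃ T : C(Y, Y), T c = d ∧ T.Homotopic (ContinuousMap.id Y)) → d ∈ S := by
    rintro c ⟨T, hT, hTh⟩ d ⟨T', hT', hTh'⟩
    refine ⟨T'.comp T, by simp [hT, hT'], ?_⟩
    simpa using hTh'.comp hTh
  have hloc : ∀ b : Y, ∃ V ∈ 𝓝 b, ∀ d ∈ V,
      (∃ T : C(Y, Y), T b = d ∧ T.Homotopic (ContinuousMap.id Y)) ∧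
      (∃ T : C(Y, Y), T d = b ∧ T.Homotopic (ContinuousMap.id Y)) := by
    intro b
    let e := chartAt (EuclideanSpace ℝ (Fin k)) b
    have hb : b ∈ e.source := mem_chart_source _ b
    obtain ⟨r, hr, hrt⟩ := Metric.isOpen_iff.1 e.open_target (e b) (e.map_source hb)
    refine ⟨e.source ∩ e ⁻¹' Metric.ball (e b) (r / 4), ?_, ?_⟩
    · exact (e.continuousOn.isOpen_inter_preimage e.open_source Metric.isOpen_ball).mem_nhds
        ⟨hb, Metric.mem_ball_self (by linarith)⟩
    · rintro d ⟨hd1, hd2⟩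
      have hd3 : ‖e d - e b‖ < r / 4 := by simpa [dist_eq_norm] using hd2
      constructor
      · obtain ⟨T, hT, hTh⟩ := push_local e (e b) (e d - e b) (r / 4) (by linarith)
          ((Metric.closedBall_subset_ball (by linarith)).trans hrt) hd3.le
        refine ⟨T, ?_, hTh⟩
        simpa [e.left_inv hb, e.left_inv hd1] using hT
      · obtain ⟨T, hT, hTh⟩ := push_local e (e d) (e b - e d) (r / 4) (by linarith)
          (by
            refine subset_trans ?_ hrt
            intro z hz
            have hz' : dist z (e d) ≤ r / 4 := hz
            have : dist z (e b) ≤ dist z (e d) + dist (e d) (e b) := dist_triangle _ _ _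
            have h2 : dist (e d) (e b) < r / 4 := hd2
            simp only [Metric.mem_ball]; linarith) (by rw [norm_sub_rev]; exact hd3.le)
        refine ⟨T, ?_, hTh⟩
        simpa [e.left_inv hb, e.left_inv hd1] using hT
  have ho : IsOpen S := by
    rw [isOpen_iff_mem_nhds]
    intro b hb
    obtain ⟨V, hV, h⟩ := hloc b
    exact Filter.mem_of_superset hV fun d hd => htr b hb d (h d hd).1
  have hcl : IsClosed S := by
    rw [← isOpen_compl_iff, isOpen_iff_mem_nhds]
    intro b hb
    obtain ⟨V, hV, h⟩ := hloc b
    exact Filter.mem_of_superset hV fun d hd hdS => hb (htr d hdS b (h d hd).2)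
  have : S = Set.univ := IsClopen.eq_univ ⟨hcl, ho⟩ ⟨a, haS⟩
  have hb : b ∈ S := this ▸ Set.mem_univ b
  exact hb

theorem lift_bdry {j : ℕ} (hj : 2 ≤ j) {X Y : Type} [TopologicalSpace X] [TopologicalSpace Y]
    {p : X → Y} (cov : IsCoveringMap p) (f : C(Fin j → I, X)) (y : Y)
    (hf : ∀ t ∈ Cube.boundary (Fin j), p (f t) = y) (t : Fin j → I)
    (ht : t ∈ Cube.boundary (Fin j)) : f t = f (fun _ => 0) := by
  classical
  have key : ∀ (P : Fin j → Prop) (t : Fin j → I),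
      (∀ s : I, (fun i => if P i then t i else s * t i) ∈ Cube.boundary (Fin j)) →
      f t = f (fun i => if P i then t i else 0) := by
    intro P t h
    have hc : Continuous fun s : I => f (fun i => if P i then t i else s * t i) := by
      refine f.continuous.comp (continuous_pi fun i => ?_)
      split_ifs <;> fun_prop
    have := cov.const_of_comp hc (fun s s' => by rw [hf _ (h s), hf _ (h s')]) 1 0
    simpa using this
  obtain ⟨i, hi⟩ := ht
  rw [key (fun l => l = i) t (fun s => ⟨i, by simpa using hi⟩)]
  obtain ⟨l, hl⟩ : ∃ l : Fin j, l ≠ i := by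
    have : Nontrivial (Fin j) := Fin.nontrivial_iff_two_le.2 hj
    exact exists_ne i
  rw [key (fun l => l ≠ i) _ (fun s => ⟨l, Or.inl (by simp [hl])⟩)]
  congr 1
  ext m
  by_cases h : m = i <;> simp [h]

theorem lift_gen {j : ℕ} (hj : 2 ≤ j) {X Y : Type} [TopologicalSpace X] [TopologicalSpace Y]
    {p : X → Y} (cov : IsCoveringMap p) {x : X} {y : Y} (hx : p x = y) (γ : GenLoop (Fin j) Y y) :
    ∃ a : GenLoop (Fin j) X x, ∀ t, p (a.1 t) = γ.1 t := by
  have h0 : (fun _ => 0 : Fin j → I) ∈ Cube.boundary (Fin j) := ⟨⟨0, by omega⟩, Or.inl rfl⟩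
  let H : C(I × (Fin j → I), Y) := ⟨fun q => γ.1 (fun i => q.1 * q.2 i), by fun_prop⟩
  have H0 : ∀ t, H (0, t) = p (ContinuousMap.const (Fin j → I) x t) := by
    intro t
    simp only [H, ContinuousMap.coe_mk, zero_mul, ContinuousMap.const_apply, hx]
    exact γ.2 _ h0
  let K := cov.liftHomotopy H (ContinuousMap.const _ x) H0
  have hK : ∀ q, p (K q) = H q := fun q => congrFun (cov.liftHomotopy_lifts H _ H0) q
  have hK0 : ∀ t, K (0, t) = x := fun t => cov.liftHomotopy_zero H _ H0 t
  let f : C(Fin j → I, X) := ⟨fun t => K (1, t), by fun_prop⟩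
  have hf : ∀ t, p (f t) = γ.1 t := by
    intro t
    simp only [f, ContinuousMap.coe_mk, hK, H, one_mul]
  have hfx : f (fun _ => 0) = x := by
    have hc : Continuous fun s : I => K (s, fun _ => 0) := by fun_prop
    have := cov.const_of_comp hc (fun s s' => by simp [hK, H]) 1 0
    rw [hK0] at this
    exact this
  refine ⟨⟨f, fun t ht => ?_⟩, hf⟩
  rw [lift_bdry hj cov f y (fun t ht => by rw [hf]; exact γ.2 t ht) t ht, hfx]

theorem lift_map {X Y : Type} [TopologicalSpace X] [TopologicalSpace Y]
    {p : X → Y} (cov : IsCoveringMap p) (T : C(Y, Y)) (hT : T.Homotopic (ContinuousMap.id Y)) :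
    ∃ T' : C(X, X), (∀ x, p (T' x) = T (p x)) ∧ T'.Homotopic (ContinuousMap.id X) := by
  obtain ⟨H⟩ := hT.symm
  have hp := cov.continuous
  let H' : C(I × X, Y) := ⟨fun q => H (q.1, p q.2), by fun_prop⟩
  have H0 : ∀ x, H' (0, x) = p (ContinuousMap.id X x) := by
    intro x; simp [H']
  let K := cov.liftHomotopy H' (ContinuousMap.id X) H0
  have hK : ∀ q, p (K q) = H' q := fun q => congrFun (cov.liftHomotopy_lifts H' _ H0) q
  have hK0 : ∀ t, K (0, t) = t := fun t => cov.liftHomotopy_zero H' _ H0 t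
  refine ⟨⟨fun x => K (1, x), by fun_prop⟩, fun x => ?_, ?_⟩
  · simp only [ContinuousMap.coe_mk, hK, H']
    simp
  · exact ContinuousMap.Homotopic.symm ⟨⟨K, hK0, fun x => rfl⟩⟩

theorem rot_homotopic {k : ℕ} (R : C(ℝ × Sph k, Sph k)) (hR : ∀ x, R (0, x) = x) (θ : ℝ) :
    (⟨fun x => R (θ, x), by fun_prop⟩ : C(Sph k, Sph k)).Homotopic (ContinuousMap.id _) := by
  refine ContinuousMap.Homotopic.symm ⟨⟨⟨fun q => R ((q.1 : ℝ) * θ, q.2), by fun_prop⟩,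
    fun x => ?_, fun x => ?_⟩⟩
  · simp [hR]
  · simp

theorem exists_anti {k : ℕ} (hk : Odd k) : ∃ A : C(Sph k, Sph k),
    (∀ x, (A x : EuclideanSpace ℝ (Fin (k + 1))) = -(x : EuclideanSpace ℝ (Fin (k + 1)))) ∧
    A.Homotopic (ContinuousMap.id _) := by
  obtain ⟨R, h1, h2, -⟩ := exists_rot hk
  exact ⟨_, h2, rot_homotopic R h1 Real.pi⟩

theorem FH_of_ne {k : ℕ} (hk : Odd k) {j : ℕ} (α β : C(Fin j → I, Sph k)) (hα : BC α) (hβ : BC β)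
    (h : ∀ t, α t ≠ β t) : FH α β := by
  obtain ⟨A, hA, hAh⟩ := exists_anti hk
  obtain ⟨H, hH, -⟩ := sph_homotopy α (A.comp β) (by
    intro t hc
    rw [ContinuousMap.comp_apply, hA, neg_neg] at hc
    exact h t (Subtype.ext hc))
  refine ContinuousMap.HomotopicWith.trans (g := A.comp β) ⟨⟨H, ?_⟩⟩ ?_
  · intro s t ht t' ht'
    exact hH s t t' (hα t ht t' ht') (congrArg A (hβ t ht t' ht'))
  · exact FH_comp hAh (ContinuousMap.HomotopicWith.refl _ hβ)

theorem homotopic_id_of_ne {k : ℕ} (hk : Odd k) (g : C(Sph k, Sph k)) (h : ∀ x, g x ≠ x) :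
    g.Homotopic (ContinuousMap.id _) := by
  obtain ⟨A, hA, hAh⟩ := exists_anti hk
  obtain ⟨H, -⟩ := sph_homotopy g A (by
    intro t hc
    rw [hA, neg_neg] at hc
    exact h t (Subtype.ext hc))
  exact ContinuousMap.Homotopic.trans ⟨H⟩ hAh

theorem core {k : ℕ} (hk : 3 ≤ k) (hkodd : Odd k) {j : ℕ} (hj : 2 ≤ j)
    (G : Type) [Group G] [MulAction G (Sph k)]
    (hcont : ∀ g : G, Continuous fun x : Sph k => g • x)
    (hfree : ∀ (g : G) (x : Sph k), g • x = x → g = 1)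
    (pc : C(Sph k, OrbQ k G)) (hpc : ∀ x, pc x = Quotient.mk _ x)
    {x y : Sph k} {y₀ : OrbQ k G} (hx : pc x = y₀) (hy : pc y = y₀)
    (α : GenLoop (Fin j) (Sph k) x) (β : GenLoop (Fin j) (Sph k) y) (h : FH α.1 β.1) :
    GenLoop.Homotopic (gcomp pc hx α) (gcomp pc hy β) := by
  have hr : (Quotient.mk _ x : OrbQ k G) = Quotient.mk _ y := by rw [← hpc, ← hpc, hx, hy]
  obtain ⟨g, hg⟩ := (MulAction.orbitRel_apply).1 (Quotient.exact hr)
  have hg : g • y = x := hg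
  let gm : C(Sph k, Sph k) := ⟨fun z => g • z, hcont g⟩
  have hgm : gm.Homotopic (ContinuousMap.id _) := by
    by_cases h1 : g = 1
    · have : gm = ContinuousMap.id _ := by ext1 z; simp [gm, h1]
      rw [this]
    · exact homotopic_id_of_ne hkodd gm fun z hz => h1 (hfree g z hz)
  have h1 : FH (gm.comp β.1) ((ContinuousMap.id _).comp β.1) :=
    FH_comp hgm (ContinuousMap.HomotopicWith.refl _ (BC_gen β))
  have h2 : FH α.1 (gcomp gm hg β).1 := ContinuousMap.HomotopicWith.trans h
    (ContinuousMap.HomotopicWith.symm h1)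
  have h3 := gcomp_homotopic pc hx (rel_of_FH (by omega) (sph_loop_null hk x) _ _ h2)
  have h4 : gcomp pc hx (gcomp gm hg β) = gcomp pc hy β := by
    apply Subtype.ext
    ext t
    change pc (g • β.1 t) = pc (β.1 t)
    rw [hpc, hpc]
    exact Quotient.sound (MulAction.orbitRel_apply.2 ⟨g, rfl⟩)
  rwa [h4] at h3

theorem spread {k : ℕ} (hkodd : Odd k) (G : Type) [Group G] [Finite G] [MulAction G (Sph k)]
    (hcont : ∀ g : G, Continuous fun x : Sph k => g • x)
    (hfree : ∀ (g : G) (x : Sph k), g • x = x → g = 1) (n : ℕ) :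
    ∃ f : Fin n → C(Sph k, Sph k), (∀ i, (f i).Homotopic (ContinuousMap.id _)) ∧
      ∀ x, Function.Injective fun i => (Quotient.mk _ (f i x) : OrbQ k G) := by
  obtain ⟨R, hR0, -, hRd, hRi⟩ := exists_rot hkodd
  have hev : ∀ᶠ ε in 𝓝[>] (0 : ℝ), ∀ g : G, g ≠ 1 → ∀ x : Sph k, ε < dist (g • x) x := by
    refine Filter.eventually_all.2 fun g => ?_
    by_cases hg : g = 1
    · simp [hg]
    have : Nonempty (Sph k) := (NormedSpace.sphere_nonempty.2 zero_le_one).to_subtype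
    have hc : Continuous fun x : Sph k => dist (g • x) x := (hcont g).dist continuous_id
    obtain ⟨x₀, -, hx₀⟩ := isCompact_univ.exists_isMinOn Set.univ_nonempty hc.continuousOn
    have hpos : 0 < dist (g • x₀) x₀ := dist_pos.2 fun h => hg (hfree g x₀ h)
    filter_upwards [Ioo_mem_nhdsGT hpos] with ε hε _ x
    exact hε.2.trans_le (hx₀ (Set.mem_univ x))
  obtain ⟨ε, hε, hε0⟩ := (hev.and self_mem_nhdsWithin).exists
  have hε0 : 0 < ε := hε0
  let δ : ℝ := min (ε / 4) 1
  have hδ0 : 0 < δ := lt_min (by linarith) one_pos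
  let θ : Fin n → ℝ := fun i => δ * ((i : ℝ) / n)
  have hθ : ∀ i, 0 ≤ θ i ∧ θ i ≤ δ := by
    intro i
    have hn : (0 : ℝ) < n := by exact_mod_cast i.pos
    have h1 : (i : ℝ) / n ≤ 1 := (div_le_one hn).2 (by exact_mod_cast i.2.le)
    have h2 : 0 ≤ (i : ℝ) / n := by positivity
    constructor
    · exact mul_nonneg hδ0.le h2
    · exact mul_le_of_le_one_right hδ0.le h1
  refine ⟨fun i => ⟨fun x => R (θ i, x), by fun_prop⟩, fun i => rot_homotopic R hR0 _, ?_⟩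
  intro x i l h
  obtain ⟨g, hg⟩ := (MulAction.orbitRel_apply).1 (Quotient.exact h)
  have hg : g • R (θ l, x) = R (θ i, x) := hg
  have hg1 : g = 1 := by
    by_contra hne
    have h1 := hε g hne (R (θ l, x))
    rw [hg] at h1
    have h2 := hRd (θ i) (θ l) x
    have h3 : |θ i - θ l| ≤ δ := by
      rw [abs_le]; constructor <;> linarith [(hθ i).1, (hθ i).2, (hθ l).1, (hθ l).2]
    have h4 : δ ≤ ε / 4 := min_le_left _ _
    linarith
  rw [hg1, one_smul] at hg
  have h1 := hRi (θ i) x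
  rw [← hg, hRi] at h1
  have hδ1 : δ ≤ 1 := min_le_right _ _
  have hpi := Real.pi_gt_three
  have h2 : θ l = θ i := Real.injOn_cos ⟨(hθ l).1, by linarith [(hθ l).2]⟩
    ⟨(hθ i).1, by linarith [(hθ i).2]⟩ h1
  have hn : (n : ℝ) ≠ 0 := by exact_mod_cast i.pos.ne'
  simp only [θ] at h2
  have h3 := mul_left_cancel₀ hδ0.ne' h2
  have h4 : (l : ℝ) = i := by field_simp at h3; exact h3
  exact Fin.ext (by exact_mod_cast h4.symm)

theorem pi_homotopic {j n : ℕ} {Y : Type} [TopologicalSpace Y] {y₀ : Y}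
    (A B : GenLoop (Fin j) (Fin n → Y) (fun _ => y₀)) (A' B' : Fin n → GenLoop (Fin j) Y y₀)
    (hA : ∀ i t, A.1 t i = (A' i).1 t) (hB : ∀ i t, B.1 t i = (B' i).1 t)
    (h : ∀ i, GenLoop.Homotopic (A' i) (B' i)) : GenLoop.Homotopic A B := by
  have H := fun i => Classical.choice (h i)
  refine ⟨⟨⟨⟨fun q i => H i q, by fun_prop⟩, fun t => ?_, fun t => ?_⟩, fun s t ht => ?_⟩⟩
  · ext i; simp [hA]
  · ext i; simp [hB]
  · ext i
    have := (H i).eq_fst s ht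
    change H i (s, t) = A.1 t i
    rw [this, hA]

theorem main_aux {k : ℕ} (hk : 3 ≤ k) (hkodd : Odd k) (j : ℕ) (hj : 2 ≤ j)
    (G : Type) [Group G] [Finite G] [MulAction G (Sph k)]
    (hcont : ∀ g : G, Continuous fun x : Sph k => g • x)
    (hfree : ∀ (g : G) (x : Sph k), g • x = x → g = 1)
    (htame : Nonempty (ChartedSpace (EuclideanSpace ℝ (Fin k)) (OrbQ k G)))
    (n : ℕ) (hn : 1 ≤ n) (q₀ : Conf n (OrbQ k G)) (y₀ : OrbQ k G) :
    ∃ (T : C((Fin n → OrbQ k G), (Fin n → OrbQ k G))) (_hT : T q₀.val = fun _ => y₀),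
      T.Homotopic (ContinuousMap.id _) ∧
      ∀ (h1 : (T.comp (⟨Subtype.val, continuous_subtype_val⟩ : C(Conf n (OrbQ k G), Fin n → OrbQ k G))) q₀
            = fun _ => y₀), 
      Set.range (piMap (Fin j)
          (T.comp (⟨Subtype.val, continuous_subtype_val⟩ : C(Conf n (OrbQ k G), Fin n → OrbQ k G)))
          (x := q₀) (y := fun _ => y₀) h1) =
        Set.range (piMap (Fin j)
          (⟨fun y _ => y, continuous_pi fun _ => continuous_id⟩ : C(OrbQ k G, Fin n → OrbQ k G))
          (x := y₀) (y := fun _ => y₀) rfl) := by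
  have i1 : ContinuousConstSMul G (Sph k) := ⟨hcont⟩
  have i2 : IsCancelSMul G (Sph k) := isCancelSMul_iff_eq_one_of_smul_eq.2 hfree
  have hcov : IsCoveringMap (Quotient.mk (MulAction.orbitRel G (Sph k))) :=
    (isQuotientCoveringMap_quotientMk_of_properlyDiscontinuousSMul).isCoveringMap
  let pc : C(Sph k, OrbQ k G) := ⟨Quotient.mk _, hcov.continuous⟩
  have hpc : ∀ x, pc x = Quotient.mk _ x := fun x => rfl
  have hcov' : IsCoveringMap pc := hcov
  have hsurj : Function.Surjective pc := Quotient.mk_surjective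
  have hfin : ∀ y, (pc ⁻¹' {y}).Finite := by
    intro y
    obtain ⟨x, rfl⟩ := hsurj y
    refine (Set.finite_range fun g : G => g • x).subset ?_
    intro z hz
    obtain ⟨g, hg⟩ := (MulAction.orbitRel_apply).1 (Quotient.exact hz)
    exact ⟨g, hg⟩
  have iinf := sph_infinite hk
  have iY : Infinite (OrbQ k G) := by
    by_contra hc
    rw [not_infinite_iff_finite] at hc
    have : (Set.univ : Set (Sph k)).Finite := by
      have : (Set.univ : Set (Sph k)) = ⋃ y : OrbQ k G, pc ⁻¹' {y} := by
        ext x; simp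
      rw [this]; exact Set.finite_iUnion hfin
    exact Set.infinite_univ this
  have iconn : PreconnectedSpace (Sph k) := by
    have h1 : 1 < Module.rank ℝ (EuclideanSpace ℝ (Fin (k + 1))) := by
      rw [← Module.finrank_eq_rank]; simp; omega
    exact isPreconnected_iff_preconnectedSpace.1 (isConnected_sphere h1 0 zero_le_one).isPreconnected
  have iYc : PreconnectedSpace (OrbQ k G) :=
    ⟨by rw [← hsurj.range_eq]; exact isPreconnected_range pc.continuous⟩
  have iT2 : T2Space (OrbQ k G) := t2Space_of_properlyDiscontinuousSMul_of_t2Space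
  obtain ⟨ich⟩ := htame
  choose T hT1 hT2 using fun i => exists_push (k := k) (q₀.1 i) y₀
  choose T' hT'1 hT'2 using fun i => lift_map hcov' (T i) (hT2 i)
  choose x hx using fun i => hsurj (q₀.1 i)
  have hbase : ∀ i, pc (T' i (x i)) = y₀ := fun i => by rw [hT'1, hx, hT1]
  let TT : C((Fin n → OrbQ k G), (Fin n → OrbQ k G)) := ⟨fun z i => T i (z i), by fun_prop⟩
  refine ⟨TT, ?_, ?_, fun h1 => ?_⟩
  · ext1 i; exact hT1 i
  · have H := fun i => Classical.choice (hT2 i)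
    refine ⟨⟨⟨fun q i => H i (q.1, q.2 i), by fun_prop⟩, fun z => ?_, fun z => ?_⟩⟩
    · ext1 i; simp [TT]
    · ext1 i; simp
  have hrefl : ∀ {x : Sph k} (a : GenLoop (Fin j) (Sph k) x), FH a.1 a.1 := fun a =>
    ContinuousMap.HomotopicWith.refl _ (BC_gen a)
  have hTa : ∀ i (a : GenLoop (Fin j) (Sph k) (x i)), FH (gcomp (T' i) rfl a).1 a.1 := fun i a =>
    FH_comp (hT'2 i) (hrefl a)
  apply Set.Subset.antisymm
  · rintro _ ⟨c, rfl⟩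
    induction c using Quotient.inductionOn with | _ γ => ?_
    let γi : ∀ i, GenLoop (Fin j) (OrbQ k G) (q₀.1 i) := fun i =>
      gcomp (⟨fun z => z.1 i, (continuous_apply i).comp continuous_subtype_val⟩ : C(Conf n (OrbQ k G), OrbQ k G)) rfl γ
    choose a ha using fun i => lift_gen hj hcov' (hx i) (γi i)
    let b : ∀ i, GenLoop (Fin j) (Sph k) (T' i (x i)) := fun i => gcomp (T' i) rfl (a i)
    let o : Fin n := ⟨0, hn⟩
    have haa : ∀ i, FH (a i).1 (a o).1 := by
      intro i
      by_cases hi : i = o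
      · subst hi; exact hrefl _
      · refine FH_of_ne hkodd _ _ (BC_gen _) (BC_gen _) fun t h => hi ?_
        have h2 : pc ((a i).1 t) = pc ((a o).1 t) := by rw [h]
        rw [ha, ha] at h2
        exact (γ.1 t).2 h2
    have hbb : ∀ i, FH (b i).1 (b o).1 := fun i =>
      ((hTa i (a i)).trans (haa i)).trans (hTa o (a o)).symm
    refine ⟨Quotient.mk _ (gcomp pc (hbase o) (b o)), ?_⟩
    refine Quotient.sound ?_
    refine GenLoop.Homotopic.symm (pi_homotopic _ _ (fun i => gcomp pc (hbase i) (b i))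
      (fun i => gcomp pc (hbase o) (b o)) ?_ ?_ ?_)
    · intro i t
      change T i ((γ.1 t).1 i) = pc (T' i ((a i).1 t))
      rw [hT'1, ha]; rfl
    · intro i t; rfl
    · intro i
      exact core hk hkodd hj G hcont hfree pc hpc _ _ _ _ (hbb i)
  · rintro _ ⟨c, rfl⟩
    induction c using Quotient.inductionOn with | _ β => ?_
    obtain ⟨y, hy⟩ := hsurj y₀
    obtain ⟨β', hβ'⟩ := lift_gen hj hcov' hy β
    obtain ⟨f, hf1, hf2⟩ := spread hkodd G hcont hfree n
    let F := {z : Fin n → Sph k // Function.Injective (pc ∘ z)}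
    let Φ : C(Sph k, F) := ⟨fun z => ⟨fun i => f i z, hf2 z⟩, by fun_prop⟩
    have hxinj : Function.Injective (pc ∘ x) := by
      have : pc ∘ x = q₀.1 := funext hx
      rw [this]; exact q₀.2
    let x' : F := ⟨x, hxinj⟩
    have hJ := conf_joinedIn pc hsurj hfin (fun s hs a b ha hb => sph_joined hk s hs a b ha hb)
      (Φ y).1 x (Φ y).2 hxinj
    obtain ⟨δ⟩ : Joined (Φ y) x' := joinedIn_iff_joined (Φ y).2 hxinj |>.1 hJ
    obtain ⟨α, hα⟩ := base_change (gcomp Φ rfl β') δ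
    let π : C(F, Conf n (OrbQ k G)) := ⟨fun z => ⟨fun i => pc (z.1 i), z.2⟩,
      Continuous.subtype_mk (continuous_pi fun i => pc.continuous.comp ((continuous_apply i).comp continuous_subtype_val)) _⟩
    have hπ : π x' = q₀ := Subtype.ext (funext hx)
    let ev : Fin n → C(F, Sph k) := fun i => ⟨fun z => z.1 i, (continuous_apply i).comp continuous_subtype_val⟩
    let a : ∀ i, GenLoop (Fin j) (Sph k) (x i) := fun i => gcomp (ev i) rfl α
    let b : ∀ i, GenLoop (Fin j) (Sph k) (T' i (x i)) := fun i => gcomp (T' i) rfl (a i)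
    have haa : ∀ i, FH (a i).1 β'.1 := by
      intro i
      have e1 : FH (a i).1 ((f i).comp β'.1) := FH_comp (ContinuousMap.Homotopic.refl (ev i)) hα
      exact e1.trans (FH_comp (hf1 i) (hrefl β'))
    refine ⟨Quotient.mk _ (gcomp π hπ α), ?_⟩
    refine Quotient.sound ?_
    refine pi_homotopic _ _ (fun i => gcomp pc (hbase i) (b i)) (fun i => gcomp pc hy β') ?_ ?_ ?_
    · intro i t
      change T i (pc ((α.1 t).1 i)) = pc (T' i ((α.1 t).1 i))
      rw [hT'1]
    · intro i t; exact (hβ' t).symm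
    · intro i
      exact core hk hkodd hj G hcont hfree pc hpc _ _ _ _ ((hTa i (a i)).trans (haa i))

/-- Let `k ≥ 3` be odd, let `G` be a finite group acting freely, continuously
and tamely on `S^k`, and let `j ≥ 2`. Then, under the identification of the homotopy groups of
`(S^k/G)^n` at the basepoints `q₀` and `(y₀,…,y₀)` (implemented by a self-map `T` homotopic to
the identity taking `q₀` to the constant configuration), the image of
`π_j(F_n(S^k/G)) → π_j((S^k/G)^n) = ∏ π_j(S^k/G)` induced by the inclusion equals the diagonal
subgroup `Δ = {(α,…,α)}`, i.e. the image of `π_j` of the diagonal map `S^k/G → (S^k/G)^n`. -/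
theorem stmt_17 {k : ℕ} (hk : 3 ≤ k) (hkodd : Odd k) (j : ℕ) (hj : 2 ≤ j)
    (G : Type) [Group G] [Finite G] [MulAction G (Sph k)]
    (hcont : ∀ g : G, Continuous fun x : Sph k => g • x)
    (hfree : ∀ (g : G) (x : Sph k), g • x = x → g = 1)
    (htame : Nonempty (ChartedSpace (EuclideanSpace ℝ (Fin k)) (OrbQ k G)))
    (n : ℕ) (hn : 1 ≤ n) (q₀ : Conf n (OrbQ k G)) (y₀ : OrbQ k G) :
    ∃ (T : C((Fin n → OrbQ k G), (Fin n → OrbQ k G))) (hT : T q₀.val = fun _ => y₀),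
      T.Homotopic (ContinuousMap.id _) ∧
      Set.range (piMap (Fin j)
          (T.comp (⟨Subtype.val, continuous_subtype_val⟩ : C(Conf n (OrbQ k G), Fin n → OrbQ k G)))
          (x := q₀) (y := fun _ => y₀)
          (by simp only [ContinuousMap.comp_apply, ContinuousMap.coe_mk]; exact hT)) =
        Set.range (piMap (Fin j)
          (⟨fun y _ => y, continuous_pi fun _ => continuous_id⟩ : C(OrbQ k G, Fin n → OrbQ k G))
          (x := y₀) (y := fun _ => y₀) rfl) := by
  obtain ⟨T, hT, h1, h2⟩ := main_aux hk hkodd j hj G hcont hfree htame n hn q₀ y₀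
  exact ⟨T, hT, h1, h2 _⟩
end
end
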